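/- arXiv:2310.02371 — 4 statements merged into one kernel-verified Lean document; each statement's English description precedes it below -/
import Mathlib

section
/- Let f : ℝ^d → ℝ be convex and L-smooth with minimizer x* and minimal value f*. Consider Nesterov-accelerated SGD iterates x_{k+1} = y_k − η g_k, z_{k+1} = z_k − γ_k η g_k, y_{k+1} = α_{k+1} z_{k+1} + (1 − α_{k+1}) x_{k+1}, starting from x_0 = y_0 = z_0, where each mini-batch gradient estimate g_k satisfies, conditionally on the history up to step k, ‖E[g_k] − ∇f(y_k)‖ ≤ δ and E[‖g_k‖²] ≤ ρ_B ‖∇f(y_k)‖² + σ²/B with ρ_B = max{1, ρ/B} and B ≥ 1 the batch size, with parameters η = 1/(ρ_B L), γ_0 = 0, γ_k = (ρ_B^{−1} + √(ρ_B^{−2} + 4γ_{k−1}²))/2, a_{k+1} = γ_k √(η ρ_B), α_k = γ_k η/(γ_k η + a_k²). Let R = ‖z_0 − x*‖ and let R̃ be an almost-sure upper bound on max{‖z_k − x*‖, ‖z_k − y_k‖} over all iterations k. Then there exists an absolute constant C such that for every N ≥ 1: E[f(x_N)] − f* ≤ C (ρ_B² L R²/N² + N σ²/(ρ_B² L B)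 + δ R̃ + N δ²/L). -/
open MeasureTheory
open scoped RealInnerProductSpace

section Convex

variable {E : Type*} [NormedAddCommGroup E] [InnerProductSpace ℝ E] [CompleteSpace E]

/-- The first-order characterization of convexity. -/
lemma ConvexOn.add_inner_gradient_le {f : E → ℝ} (hc : ConvexOn ℝ Set.univ f)
    (hd : Differentiable ℝ f) (u v : E) : f u + ⟪gradient f u, v - u⟫ ≤ f v := by
  have hline : HasDerivAt (f ∘ AffineMap.lineMap (k := ℝ) u v) ⟪gradient f u, v - u⟫ 0 := by
    have h1 : HasFDerivAt f (fderiv ℝ f u) (AffineMap.lineMap (k := ℝ) u v 0) := by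
      simpa using (hd u).hasFDerivAt
    have h2 : HasDerivAt (AffineMap.lineMap (k := ℝ) u v) (v - u) 0 :=
      AffineMap.hasDerivAt_lineMap
    simpa [gradient] using h1.comp_hasDerivAt (0 : ℝ) h2
  have h := (hc.comp_affineMap (AffineMap.lineMap (k := ℝ) u v)).le_slope_of_hasDerivAt
    (Set.mem_univ (0 : ℝ)) (Set.mem_univ 1) one_pos hline
  simp only [slope, Function.comp_apply, AffineMap.lineMap_apply_one, AffineMap.lineMap_apply_zero,
    sub_zero, inv_one, vsub_eq_sub, one_smul] at h
  linarith

lemma gradient_eq_zero_of_forall_le {f : E → ℝ} {u₀ : E} (hmin : ∀ u, f u₀ ≤ f u) :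
    gradient f u₀ = 0 := by
  have h : IsLocalMin f u₀ := Filter.Eventually.of_forall hmin
  simp [gradient, h.fderiv_eq_zero]

lemma sub_min_le_of_smooth {f : E → ℝ} {L : ℝ} {u₀ : E}
    (hL : ∀ u v, f v ≤ f u + ⟪gradient f u, v - u⟫ + L / 2 * ‖v - u‖ ^ 2)
    (hmin : ∀ u, f u₀ ≤ f u) (u : E) : f u - f u₀ ≤ L / 2 * ‖u - u₀‖ ^ 2 := by
  have h := hL u₀ u
  rw [gradient_eq_zero_of_forall_le hmin, inner_zero_left] at h
  linarith

lemma norm_gradient_le_of_smooth {f : E → ℝ} {L : ℝ} {u₀ : E} (hL0 : 0 < L)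
    (hL : ∀ u v, f v ≤ f u + ⟪gradient f u, v - u⟫ + L / 2 * ‖v - u‖ ^ 2)
    (hmin : ∀ u, f u₀ ≤ f u) (u : E) : ‖gradient f u‖ ≤ L * ‖u - u₀‖ := by
  have h1 := hL u (u - L⁻¹ • gradient f u)
  have h2 := hmin (u - L⁻¹ • gradient f u)
  have h3 := sub_min_le_of_smooth hL hmin u
  rw [sub_sub_cancel_left, inner_neg_right, inner_smul_right, real_inner_self_eq_norm_sq,
    norm_neg, norm_smul, Real.norm_of_nonneg (inv_nonneg.2 hL0.le)] at h1
  have h4 : L / 2 * (L⁻¹ * ‖gradient f u‖) ^ 2 = L⁻¹ * ‖gradient f u‖ ^ 2 / 2 := by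
    field_simp
  have h5 : L⁻¹ * ‖gradient f u‖ ^ 2 ≤ L * ‖u - u₀‖ ^ 2 := by linarith
  have h6 : ‖gradient f u‖ ^ 2 ≤ (L * ‖u - u₀‖) ^ 2 := by
    calc ‖gradient f u‖ ^ 2 = L * (L⁻¹ * ‖gradient f u‖ ^ 2) := by field_simp
      _ ≤ L * (L * ‖u - u₀‖ ^ 2) := by gcongr
      _ = _ := by ring
  exact le_of_sq_le_sq h6 (by positivity)

lemma measurable_gradient [MeasurableSpace E] [BorelSpace E] (f : E → ℝ) :
    Measurable (gradient f) :=
  (InnerProductSpace.toDual ℝ E).symm.continuous.measurable.comp (measurable_fderiv ℝ f)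

end Convex

section Oracle

variable {E Ω : Type*} [NormedAddCommGroup E] [InnerProductSpace ℝ E]
  {m mΩ : MeasurableSpace Ω} {μ : Measure Ω}

lemma MeasureTheory.Integrable.inner_of_norm_le {u g : Ω → E} {K : ℝ} (hg : Integrable g μ)
    (hu : AEStronglyMeasurable u μ) (hK : ∀ᵐ ω ∂μ, ‖u ω‖ ≤ K) :
    Integrable (fun ω => ⟪u ω, g ω⟫) μ := by
  refine (hg.norm.const_mul K).mono' (hu.inner hg.aestronglyMeasurable) ?_
  filter_upwards [hK] with ω hω
  exact (norm_inner_le_norm _ _).trans (by gcongr)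

omit [InnerProductSpace ℝ E] in
lemma MeasureTheory.integrable_norm_sq_of_norm_le [IsFiniteMeasure μ] {u : Ω → E} {K : ℝ}
    (hu : AEStronglyMeasurable u μ) (hK : ∀ᵐ ω ∂μ, ‖u ω‖ ≤ K) :
    Integrable (fun ω => ‖u ω‖ ^ 2) μ := by
  refine Integrable.of_bound (hu.norm.pow 2) (K ^ 2) ?_
  filter_upwards [hK] with ω hω
  rw [Real.norm_of_nonneg (by positivity)]
  gcongr

/-- Testing a vector with conditional bias at most `δ` against a bounded, conditionally known
direction loses at most `δ` times the expected length of that direction. -/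
lemma integral_inner_sub_le_of_condExp_bias [CompleteSpace E] [IsFiniteMeasure μ]
    (hm : m ≤ mΩ) {g u h : Ω → E} {δ K : ℝ} (hg : Integrable g μ)
    (hu : StronglyMeasurable[m] u) (hK : ∀ᵐ ω ∂μ, ‖u ω‖ ≤ K)
    (huh : Integrable (fun ω => ⟪u ω, h ω⟫) μ)
    (hb : ∀ᵐ ω ∂μ, ‖(μ[g | m]) ω - h ω‖ ≤ δ) :
    (∫ ω, ⟪u ω, h ω⟫ ∂μ) - δ * ∫ ω, ‖u ω‖ ∂μ ≤ ∫ ω, ⟪u ω, g ω⟫ ∂μ := by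
  have hu' : AEStronglyMeasurable u μ := (hu.mono hm).aestronglyMeasurable
  have hnorm : Integrable (fun ω => ‖u ω‖) μ := (Integrable.of_bound hu' K hK).norm
  have hug := hg.inner_of_norm_le hu' hK
  have hpull : μ[fun ω => ⟪u ω, g ω⟫ | m] =ᵐ[μ] fun ω => ⟪u ω, (μ[g | m]) ω⟫ :=
    condExp_bilin_of_stronglyMeasurable_left (innerSL ℝ) hu hug hg
  rw [← integral_condExp hm (f := fun ω => ⟪u ω, g ω⟫), integral_congr_ae hpull,
    ← integral_const_mul, ← integral_sub huh (hnorm.const_mul δ)]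
  refine integral_mono_ae (huh.sub (hnorm.const_mul δ))
    (integrable_condExp.inner_of_norm_le hu' hK) ?_
  filter_upwards [hb] with ω hω
  have h1 := (abs_le.1 (abs_real_inner_le_norm (u ω) ((μ[g | m]) ω - h ω))).1
  rw [inner_sub_right] at h1
  have h2 : ‖u ω‖ * ‖(μ[g | m]) ω - h ω‖ ≤ ‖u ω‖ * δ := by gcongr
  linarith

/-- Expected decrease along a gradient step with a biased gradient estimate. -/
lemma integral_gradient_step_le [CompleteSpace E] [IsFiniteMeasure μ] [MeasurableSpace E]
    [BorelSpace E] [SecondCountableTopology E]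
    (hm : m ≤ mΩ) {f : E → ℝ} {L η δ K : ℝ} (hη : 0 ≤ η)
    (hL : ∀ u v, f v ≤ f u + ⟪gradient f u, v - u⟫ + L / 2 * ‖v - u‖ ^ 2)
    {y g : Ω → E} (hy : Measurable[m] y) (hK : ∀ᵐ ω ∂μ, ‖gradient f (y ω)‖ ≤ K)
    (hg : Integrable g μ) (hg2 : Integrable (fun ω => ‖g ω‖ ^ 2) μ)
    (hfy : Integrable (fun ω => f (y ω)) μ)
    (hfx : Integrable (fun ω => f (y ω - η • g ω)) μ)
    (hb : ∀ᵐ ω ∂μ, ‖(μ[g | m]) ω - gradient f (y ω)‖ ≤ δ) :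
    ∫ ω, f (y ω - η • g ω) ∂μ ≤ (∫ ω, f (y ω) ∂μ)
      - η * ((∫ ω, ‖gradient f (y ω)‖ ^ 2 ∂μ) - δ * ∫ ω, ‖gradient f (y ω)‖ ∂μ)
      + L * η ^ 2 / 2 * ∫ ω, ‖g ω‖ ^ 2 ∂μ := by
  have hu : StronglyMeasurable[m] fun ω => gradient f (y ω) :=
    ((measurable_gradient f).comp hy).stronglyMeasurable
  have hu' : AEStronglyMeasurable (fun ω => gradient f (y ω)) μ :=
    (hu.mono hm).aestronglyMeasurable
  have hsq : Integrable (fun ω => ⟪gradient f (y ω), gradient f (y ω)⟫) μ := by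
    simpa only [real_inner_self_eq_norm_sq] using integrable_norm_sq_of_norm_le hu' hK
  have hbias := integral_inner_sub_le_of_condExp_bias hm hg hu hK hsq hb
  simp only [real_inner_self_eq_norm_sq] at hbias
  have hug := hg.inner_of_norm_le hu' hK
  calc ∫ ω, f (y ω - η • g ω) ∂μ
      ≤ ∫ ω, (f (y ω) - η * ⟪gradient f (y ω), g ω⟫ + L * η ^ 2 / 2 * ‖g ω‖ ^ 2) ∂μ := by
        refine integral_mono hfx ((hfy.sub (hug.const_mul η)).add (hg2.const_mul _)) fun ω => ?_
        have h := hL (y ω) (y ω - η • g ω)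
        rw [sub_sub_cancel_left, inner_neg_right, inner_smul_right, norm_neg, norm_smul,
          mul_pow, Real.norm_eq_abs, sq_abs] at h
        change _ ≤ f (y ω) - η * ⟪gradient f (y ω), g ω⟫ + L * η ^ 2 / 2 * ‖g ω‖ ^ 2
        linarith
    _ = (∫ ω, f (y ω) ∂μ) - η * (∫ ω, ⟪gradient f (y ω), g ω⟫ ∂μ)
          + L * η ^ 2 / 2 * ∫ ω, ‖g ω‖ ^ 2 ∂μ := by
        have hsub : Integrable (fun ω => f (y ω) - η * ⟪gradient f (y ω), g ω⟫) μ :=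
          hfy.sub (hug.const_mul η)
        rw [integral_add hsub (hg2.const_mul _),
          integral_sub hfy (hug.const_mul η), integral_const_mul, integral_const_mul]
    _ ≤ _ := by gcongr

/-- Expected change of the squared distance to a point `p` along a step in the direction of a
biased estimate of `h`. -/
lemma integral_norm_sq_step_le [CompleteSpace E] [IsProbabilityMeasure μ]
    (hm : m ≤ mΩ) {t δ K : ℝ} (ht : 0 ≤ t) (hδ : 0 ≤ δ)
    {z g h : Ω → E} (p : E) (hz : StronglyMeasurable[m] z) (hK : ∀ᵐ ω ∂μ, ‖z ω - p‖ ≤ K)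
    (hg : Integrable g μ) (hg2 : Integrable (fun ω => ‖g ω‖ ^ 2) μ) (hh : Integrable h μ)
    (hb : ∀ᵐ ω ∂μ, ‖(μ[g | m]) ω - h ω‖ ≤ δ) :
    ∫ ω, ‖z ω - t • g ω - p‖ ^ 2 ∂μ ≤ (∫ ω, ‖z ω - p‖ ^ 2 ∂μ)
      - 2 * t * ((∫ ω, ⟪z ω - p, h ω⟫ ∂μ) - δ * K) + t ^ 2 * ∫ ω, ‖g ω‖ ^ 2 ∂μ := by
  have hu : StronglyMeasurable[m] fun ω => z ω - p := hz.sub stronglyMeasurable_const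
  have hu' : AEStronglyMeasurable (fun ω => z ω - p) μ := (hu.mono hm).aestronglyMeasurable
  have hsq := integrable_norm_sq_of_norm_le hu' hK
  have hbias := integral_inner_sub_le_of_condExp_bias hm hg hu hK (hh.inner_of_norm_le hu' hK) hb
  have hug := hg.inner_of_norm_le hu' hK
  have hnorm : ∫ ω, ‖z ω - p‖ ∂μ ≤ K := by
    calc ∫ ω, ‖z ω - p‖ ∂μ ≤ ∫ _, K ∂μ :=
          integral_mono_ae (Integrable.of_bound hu' K hK).norm (integrable_const K) hK
      _ = K := by simp
  have hexp : ∀ ω, ‖z ω - t • g ω - p‖ ^ 2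
      = ‖z ω - p‖ ^ 2 - 2 * t * ⟪z ω - p, g ω⟫ + t ^ 2 * ‖g ω‖ ^ 2 := fun ω => by
    rw [sub_right_comm, norm_sub_sq_real, inner_smul_right, norm_smul, mul_pow, Real.norm_eq_abs,
      sq_abs]
    ring
  have hsub : Integrable (fun ω => ‖z ω - p‖ ^ 2 - 2 * t * ⟪z ω - p, g ω⟫) μ :=
    hsq.sub (hug.const_mul _)
  simp only [hexp]
  rw [integral_add hsub (hg2.const_mul _),
    integral_sub hsq (hug.const_mul _), integral_const_mul, integral_const_mul]
  have : δ * ∫ ω, ‖z ω - p‖ ∂μ ≤ δ * K := by gcongr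
  gcongr
  linarith

end Oracle

section Step

variable {E Ω : Type*} [NormedAddCommGroup E] [InnerProductSpace ℝ E] [CompleteSpace E]
  [MeasurableSpace E] [BorelSpace E] [SecondCountableTopology E]
  {m mΩ : MeasurableSpace Ω} {μ : Measure Ω} [IsProbabilityMeasure μ]

omit [SecondCountableTopology E] in
lemma integrable_comp_of_smooth {f : E → ℝ} {L K : ℝ} {p : E} (hL0 : 0 < L)
    (hd : Differentiable ℝ f)
    (hL : ∀ u v, f v ≤ f u + ⟪gradient f u, v - u⟫ + L / 2 * ‖v - u‖ ^ 2)
    (hmin : ∀ u, f p ≤ f u) {y : Ω → E} (hy : Measurable[mΩ] y)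
    (hK : ∀ᵐ ω ∂μ, ‖y ω - p‖ ≤ K) : Integrable (fun ω => f (y ω)) μ := by
  have h : Integrable (fun ω => f (y ω) - f p) μ := by
    refine Integrable.of_bound
      ((hd.continuous.measurable.comp hy).sub_const _).aestronglyMeasurable (L / 2 * K ^ 2) ?_
    filter_upwards [hK] with ω hω
    rw [Real.norm_of_nonneg (sub_nonneg.2 (hmin _))]
    exact (sub_min_le_of_smooth hL hmin _).trans (by gcongr)
  exact (h.add (integrable_const (f p))).congr (ae_of_all _ fun ω => sub_add_cancel _ _)

lemma integral_norm_sq_le_of_condExp_le (hm : m ≤ mΩ) {f : E → ℝ} {ρ s K : ℝ} {y g : Ω → E}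
    (hy : Measurable[m] y) (hK : ∀ᵐ ω ∂μ, ‖gradient f (y ω)‖ ≤ K)
    (hV : ∀ᵐ ω ∂μ, (μ[fun ω' => ‖g ω'‖ ^ 2 | m]) ω ≤ ρ * ‖gradient f (y ω)‖ ^ 2 + s) :
    ∫ ω, ‖g ω‖ ^ 2 ∂μ ≤ ρ * (∫ ω, ‖gradient f (y ω)‖ ^ 2 ∂μ) + s := by
  have hu : AEStronglyMeasurable (fun ω => gradient f (y ω)) μ :=
    (((measurable_gradient f).comp hy).mono hm le_rfl).aestronglyMeasurable
  have hsq := (integrable_norm_sq_of_norm_le hu hK).const_mul ρ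
  rw [← integral_condExp hm (f := fun ω => ‖g ω‖ ^ 2)]
  calc _ ≤ ∫ ω, (ρ * ‖gradient f (y ω)‖ ^ 2 + s) ∂μ :=
        integral_mono_ae integrable_condExp (hsq.add (integrable_const s)) hV
    _ = _ := by rw [integral_add hsq (integrable_const s), integral_const_mul]; simp

/-- The expected value after a first gradient step with a biased gradient estimate. -/
lemma integral_gradient_step_sub_min_le (hm : m ≤ mΩ) {f : E → ℝ} {L ρ η δ s K : ℝ} {p : E}
    (hL0 : 0 < L) (hρ : 1 ≤ ρ) (hη : η * ρ * L = 1) (hd : Differentiable ℝ f)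
    (hL : ∀ u v, f v ≤ f u + ⟪gradient f u, v - u⟫ + L / 2 * ‖v - u‖ ^ 2)
    (hmin : ∀ u, f p ≤ f u) {y g : Ω → E} (hy : Measurable[m] y)
    (hg : Integrable g μ) (hg2 : Integrable (fun ω => ‖g ω‖ ^ 2) μ)
    (hfx : Integrable (fun ω => f (y ω - η • g ω)) μ)
    (hb : ∀ᵐ ω ∂μ, ‖(μ[g | m]) ω - gradient f (y ω)‖ ≤ δ)
    (hV : ∀ᵐ ω ∂μ, (μ[fun ω' => ‖g ω'‖ ^ 2 | m]) ω ≤ ρ * ‖gradient f (y ω)‖ ^ 2 + s)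
    (hK : ∀ᵐ ω ∂μ, ‖y ω - p‖ ≤ K) :
    (∫ ω, f (y ω - η • g ω) ∂μ) - f p
      ≤ L / 2 * K ^ 2 + η * δ ^ 2 / 2 + η * s / (2 * ρ) := by
  have hρ0 : 0 < ρ := by linarith
  have hη0 : 0 < η := by
    have : 0 < η * (ρ * L) := by rw [← mul_assoc, hη]; exact one_pos
    exact pos_of_mul_pos_left this (by positivity)
  have hK' : ∀ᵐ ω ∂μ, ‖gradient f (y ω)‖ ≤ L * K := by
    filter_upwards [hK] with ω hω
    exact (norm_gradient_le_of_smooth hL0 hL hmin _).trans (by gcongr)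
  have hu : AEStronglyMeasurable (fun ω => gradient f (y ω)) μ :=
    (((measurable_gradient f).comp hy).mono hm le_rfl).aestronglyMeasurable
  have hfy := integrable_comp_of_smooth hL0 hd hL hmin (hy.mono hm le_rfl) hK
  have hstep := integral_gradient_step_le hm hη0.le hL hy hK' hg hg2 hfy hfx hb
  have hmoment := integral_norm_sq_le_of_condExp_le hm hy hK' hV
  have hF : ∫ ω, f (y ω) ∂μ ≤ L / 2 * K ^ 2 + f p := by
    calc ∫ ω, f (y ω) ∂μ ≤ ∫ _, (L / 2 * K ^ 2 + f p) ∂μ := by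
          refine integral_mono_ae hfy (integrable_const _) ?_
          filter_upwards [hK] with ω hω
          have h1 := sub_min_le_of_smooth hL hmin (y ω)
          have h2 : L / 2 * ‖y ω - p‖ ^ 2 ≤ L / 2 * K ^ 2 := by gcongr
          linarith
      _ = _ := by simp
  have hM : 2 * δ * (∫ ω, ‖gradient f (y ω)‖ ∂μ)
      ≤ (∫ ω, ‖gradient f (y ω)‖ ^ 2 ∂μ) + δ ^ 2 := by
    have hi := integrable_norm_sq_of_norm_le hu hK'
    calc _ = ∫ ω, 2 * δ * ‖gradient f (y ω)‖ ∂μ := (integral_const_mul _ _).symm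
      _ ≤ ∫ ω, (‖gradient f (y ω)‖ ^ 2 + δ ^ 2) ∂μ := by
          refine integral_mono ((Integrable.of_bound hu _ hK').norm.const_mul _)
            (hi.add (integrable_const _)) fun ω => ?_
          change 2 * δ * ‖gradient f (y ω)‖ ≤ ‖gradient f (y ω)‖ ^ 2 + δ ^ 2
          nlinarith [sq_nonneg (‖gradient f (y ω)‖ - δ)]
      _ = _ := by rw [integral_add hi (integrable_const _)]; simp
  generalize (∫ ω, ‖g ω‖ ^ 2 ∂μ) = V at *
  generalize (∫ ω, ‖gradient f (y ω)‖ ^ 2 ∂μ) = G at *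
  generalize (∫ ω, ‖gradient f (y ω)‖ ∂μ) = M at *
  have hLη : L * η ^ 2 / 2 = η / (2 * ρ) := by
    field_simp
    linear_combination hη
  have h1 : L * η ^ 2 / 2 * V ≤ η * G / 2 + η * s / (2 * ρ) := by
    calc L * η ^ 2 / 2 * V ≤ η / (2 * ρ) * (ρ * G + s) := by rw [hLη]; gcongr
      _ = _ := by field_simp
  have h2 := mul_le_mul_of_nonneg_left hM hη0.le
  linarith

/-- One step of the potential argument for the accelerated method: the squared distance of `z` to
the minimizer enters the potential with the damped weight `1 - ε`, and the resulting slack in the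
squared gradient absorbs the part of the bias that is proportional to the gradient. -/
lemma agd_potential_step (hm : m ≤ mΩ) {f : E → ℝ} {L ρ η δ s K γ q ε c : ℝ} {p : E}
    (hL0 : 0 < L) (hρ : 1 ≤ ρ) (hη : η * ρ * L = 1) (hδ : 0 ≤ δ) (hs : 0 ≤ s)
    (hγ : 0 ≤ γ) (hq : 0 ≤ q) (hγq : ρ * γ ^ 2 = γ + ρ * q)
    (hε : 0 ≤ ε) (hε1 : ε ≤ 1) (hc : 0 ≤ c) (hεc : 2 * δ ^ 2 ≤ ε * c)
    (hconv : ConvexOn ℝ Set.univ f) (hd : Differentiable ℝ f)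
    (hL : ∀ u v, f v ≤ f u + ⟪gradient f u, v - u⟫ + L / 2 * ‖v - u‖ ^ 2)
    (hmin : ∀ u, f p ≤ f u) {x y z g : Ω → E}
    (hy : Measurable[m] y) (hz : Measurable[m] z)
    (hyz : ∀ ω, γ • z ω = (ρ * γ ^ 2) • y ω - (ρ * q) • x ω)
    (hg : Integrable g μ) (hg2 : Integrable (fun ω => ‖g ω‖ ^ 2) μ)
    (hfx : Integrable (fun ω => f (x ω)) μ)
    (hfx' : Integrable (fun ω => f (y ω - η • g ω)) μ)
    (hb : ∀ᵐ ω ∂μ, ‖(μ[g | m]) ω - gradient f (y ω)‖ ≤ δ)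
    (hV : ∀ᵐ ω ∂μ, (μ[fun ω' => ‖g ω'‖ ^ 2 | m]) ω ≤ ρ * ‖gradient f (y ω)‖ ^ 2 + s)
    (hK : ∀ᵐ ω ∂μ, ‖z ω - p‖ ≤ K ∧ ‖z ω - y ω‖ ≤ K) :
    2 * (η * ρ) * γ ^ 2 * ((∫ ω, f (y ω - η • g ω) ∂μ) - f p)
        + (1 - ε) * ∫ ω, ‖z ω - (γ * η) • g ω - p‖ ^ 2 ∂μ
      ≤ 2 * (η * ρ) * q * ((∫ ω, f (x ω) ∂μ) - f p) + (1 - ε) * (∫ ω, ‖z ω - p‖ ^ 2 ∂μ)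
        + (2 * (γ * η * δ * K) + 2 * (γ ^ 2 * η ^ 2 * s) + γ ^ 2 * η ^ 2 * ρ * c
          + 2 * (ε * (K ^ 2 / ρ))) := by
  have hρ0 : 0 < ρ := by linarith
  have hη0 : 0 < η := by
    have : 0 < η * (ρ * L) := by rw [← mul_assoc, hη]; exact one_pos
    exact pos_of_mul_pos_left this (by positivity)
  have hK0 : 0 ≤ K := by
    obtain ⟨ω, hω⟩ := hK.exists
    exact (norm_nonneg _).trans hω.1
  have hzK : ∀ᵐ ω ∂μ, ‖z ω - p‖ ≤ K := hK.mono fun ω hω => hω.1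
  have hyK : ∀ᵐ ω ∂μ, ‖y ω - p‖ ≤ 2 * K := by
    filter_upwards [hK] with ω hω
    calc ‖y ω - p‖ = ‖(z ω - p) - (z ω - y ω)‖ := by rw [sub_sub_sub_cancel_left]
      _ ≤ ‖z ω - p‖ + ‖z ω - y ω‖ := norm_sub_le _ _
      _ ≤ 2 * K := by linarith [hω.1, hω.2]
  have hgK : ∀ᵐ ω ∂μ, ‖gradient f (y ω)‖ ≤ L * (2 * K) := by
    filter_upwards [hyK] with ω hω
    exact (norm_gradient_le_of_smooth hL0 hL hmin _).trans (by gcongr)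
  have hu : AEStronglyMeasurable (fun ω => gradient f (y ω)) μ :=
    (((measurable_gradient f).comp hy).mono hm le_rfl).aestronglyMeasurable
  have huI : Integrable (fun ω => gradient f (y ω)) μ := Integrable.of_bound hu _ hgK
  have hfy := integrable_comp_of_smooth hL0 hd hL hmin (hy.mono hm le_rfl) hyK
  have hGI := integrable_norm_sq_of_norm_le hu hgK
  have hDI : Integrable (fun ω => ⟪z ω - p, gradient f (y ω)⟫) μ :=
    huI.inner_of_norm_le ((hz.mono hm le_rfl).sub_const p).aestronglyMeasurable hzK
  have hstep := integral_gradient_step_le hm hη0.le hL hy hgK hg hg2 hfy hfx' hb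
  have hmoment := integral_norm_sq_le_of_condExp_le hm hy hgK hV
  have hdist := integral_norm_sq_step_le hm (mul_nonneg hγ hη0.le) hδ p hz.stronglyMeasurable hzK
    hg hg2 huI hb
  have hcoupling : ρ * γ ^ 2 * ((∫ ω, f (y ω) ∂μ) - f p) - ρ * q * ((∫ ω, f (x ω) ∂μ) - f p)
      ≤ γ * ∫ ω, ⟪z ω - p, gradient f (y ω)⟫ ∂μ := by
    have hyI : Integrable (fun ω => ρ * γ ^ 2 * (f (y ω) - f p)) μ :=
      (hfy.sub (integrable_const (f p))).const_mul (ρ * γ ^ 2)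
    have hxI : Integrable (fun ω => ρ * q * (f (x ω) - f p)) μ :=
      (hfx.sub (integrable_const (f p))).const_mul (ρ * q)
    calc _ = ∫ ω, (ρ * γ ^ 2 * (f (y ω) - f p) - ρ * q * (f (x ω) - f p)) ∂μ := by
          rw [integral_sub hyI hxI, integral_const_mul, integral_const_mul,
            integral_sub hfy (integrable_const _), integral_sub hfx (integrable_const _)]
          simp
      _ ≤ ∫ ω, γ * ⟪z ω - p, gradient f (y ω)⟫ ∂μ := by
          refine integral_mono (hyI.sub hxI) (hDI.const_mul γ) fun ω => ?_
          change ρ * γ ^ 2 * (f (y ω) - f p) - ρ * q * (f (x ω) - f p)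
            ≤ γ * ⟪z ω - p, gradient f (y ω)⟫
          have hdir : γ • (z ω - p) = -((ρ * q) • (x ω - y ω) + γ • (p - y ω)) := by
            rw [smul_sub, hyz, hγq]
            module
          rw [← real_inner_smul_left, hdir, inner_neg_left, inner_add_left, real_inner_smul_left,
            real_inner_smul_left, real_inner_comm, real_inner_comm _ (p - y ω)]
          have h1 := mul_le_mul_of_nonneg_left (hconv.add_inner_gradient_le hd (y ω) (x ω))
            (mul_nonneg hρ0.le hq)
          have h2 := mul_le_mul_of_nonneg_left (hconv.add_inner_gradient_le hd (y ω) p) hγ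
          rw [hγq]
          linarith
      _ = _ := integral_const_mul _ _
  have hyoung : 2 * (γ * η) * (∫ ω, ⟪z ω - p, gradient f (y ω)⟫ ∂μ)
      ≤ γ ^ 2 * η ^ 2 * ρ / 2 * (∫ ω, ‖gradient f (y ω)‖ ^ 2 ∂μ) + 2 * (K ^ 2 / ρ) := by
    calc _ = ∫ ω, 2 * (γ * η) * ⟪z ω - p, gradient f (y ω)⟫ ∂μ := (integral_const_mul _ _).symm
      _ ≤ ∫ ω, (γ ^ 2 * η ^ 2 * ρ / 2 * ‖gradient f (y ω)‖ ^ 2 + 2 * (K ^ 2 / ρ)) ∂μ := by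
          refine integral_mono_ae (hDI.const_mul _)
            ((hGI.const_mul _).add (integrable_const _)) ?_
          filter_upwards [hzK] with ω hω
          have h1 : ⟪z ω - p, gradient f (y ω)⟫ ≤ K * ‖gradient f (y ω)‖ :=
            (real_inner_le_norm _ _).trans (by gcongr)
          have h2 : 0 ≤ ρ / 2 * (γ * η * ‖gradient f (y ω)‖ - 2 * (K / ρ)) ^ 2 := by positivity
          have h3 : ρ / 2 * (γ * η * ‖gradient f (y ω)‖ - 2 * (K / ρ)) ^ 2
              = γ ^ 2 * η ^ 2 * ρ / 2 * ‖gradient f (y ω)‖ ^ 2 + 2 * (K ^ 2 / ρ)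
                - 2 * (γ * η) * (K * ‖gradient f (y ω)‖) := by
            field_simp
            ring
          have h4 : 2 * (γ * η) * ⟪z ω - p, gradient f (y ω)⟫
              ≤ 2 * (γ * η) * (K * ‖gradient f (y ω)‖) := by gcongr
          linarith
      _ = _ := by
          rw [integral_add (hGI.const_mul _) (integrable_const _), integral_const_mul]
          simp
  have hM : 2 * δ * (∫ ω, ‖gradient f (y ω)‖ ∂μ)
      ≤ ε / 2 * (∫ ω, ‖gradient f (y ω)‖ ^ 2 ∂μ) + c := by
    calc _ = ∫ ω, 2 * δ * ‖gradient f (y ω)‖ ∂μ := (integral_const_mul _ _).symm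
      _ ≤ ∫ ω, (ε / 2 * ‖gradient f (y ω)‖ ^ 2 + c) ∂μ := by
          refine integral_mono (huI.norm.const_mul _)
            ((hGI.const_mul _).add (integrable_const _)) fun ω => ?_
          change 2 * δ * ‖gradient f (y ω)‖ ≤ ε / 2 * ‖gradient f (y ω)‖ ^ 2 + c
          refine le_of_sq_le_sq ?_ (by positivity)
          have h1 := mul_le_mul_of_nonneg_right hεc (sq_nonneg ‖gradient f (y ω)‖)
          nlinarith [sq_nonneg (ε / 2 * ‖gradient f (y ω)‖ ^ 2 - c)]
      _ = _ := by
          rw [integral_add (hGI.const_mul _) (integrable_const _), integral_const_mul]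
          simp
  generalize (∫ ω, ‖g ω‖ ^ 2 ∂μ) = V at *
  generalize (∫ ω, ‖gradient f (y ω)‖ ^ 2 ∂μ) = G at *
  generalize (∫ ω, ‖gradient f (y ω)‖ ∂μ) = M at *
  generalize (∫ ω, ⟪z ω - p, gradient f (y ω)⟫ ∂μ) = D at *
  generalize (∫ ω, f (y ω) ∂μ) = F at *
  generalize (∫ ω, f (x ω) ∂μ) = X at *
  generalize (∫ ω, f (y ω - η • g ω) ∂μ) = X' at *
  generalize (∫ ω, ‖z ω - p‖ ^ 2 ∂μ) = Z at *
  generalize (∫ ω, ‖z ω - (γ * η) • g ω - p‖ ^ 2 ∂μ) = Z' at *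
  have h1 := mul_le_mul_of_nonneg_left hstep (by positivity : 0 ≤ 2 * (η * ρ) * γ ^ 2)
  have h2 := mul_le_mul_of_nonneg_left hdist (sub_nonneg.2 hε1)
  have h3 := mul_le_mul_of_nonneg_left hmoment
    (mul_nonneg (by linarith) (by positivity) : 0 ≤ (2 - ε) * (γ ^ 2 * η ^ 2))
  have h4 := mul_le_mul_of_nonneg_left hcoupling (by positivity : 0 ≤ 2 * η)
  have h5 := mul_le_mul_of_nonneg_left hyoung hε
  have h6 := mul_le_mul_of_nonneg_left hM (by positivity : 0 ≤ γ ^ 2 * η ^ 2 * ρ)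
  have h7 : 0 ≤ ε * (γ * η * δ * K) := by positivity
  have h8 : 0 ≤ ε * (γ ^ 2 * η ^ 2 * s) := by positivity
  have h9 : 2 * (η * ρ) * γ ^ 2 * (L * η ^ 2 / 2 * V) = γ ^ 2 * η ^ 2 * V := by
    linear_combination γ ^ 2 * η ^ 2 * V * hη
  linarith

end Step

section Momentum

variable {ρ : ℝ} {γ : ℕ → ℝ}

lemma momentum_nonneg (hρ : 0 < ρ) (h0 : γ 0 = 0)
    (hrec : ∀ k, γ (k + 1) = (ρ⁻¹ + Real.sqrt (ρ⁻¹ ^ 2 + 4 * γ k ^ 2)) / 2) (k : ℕ) :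
    0 ≤ γ k := by
  cases k with
  | zero => exact h0.ge
  | succ k => rw [hrec]; positivity

lemma mul_momentum_sq (hρ : 0 < ρ)
    (hrec : ∀ k, γ (k + 1) = (ρ⁻¹ + Real.sqrt (ρ⁻¹ ^ 2 + 4 * γ k ^ 2)) / 2) (k : ℕ) :
    ρ * γ (k + 1) ^ 2 = γ (k + 1) + ρ * γ k ^ 2 := by
  have hs := Real.sq_sqrt (by positivity : 0 ≤ ρ⁻¹ ^ 2 + 4 * γ k ^ 2)
  have hρi : ρ * ρ⁻¹ = 1 := mul_inv_cancel₀ hρ.ne'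
  rw [hrec]
  generalize Real.sqrt (ρ⁻¹ ^ 2 + 4 * γ k ^ 2) = r at *
  linear_combination ρ / 4 * hs + (ρ⁻¹ + r) / 2 * hρi

lemma momentum_add_le_succ
    (hrec : ∀ k, γ (k + 1) = (ρ⁻¹ + Real.sqrt (ρ⁻¹ ^ 2 + 4 * γ k ^ 2)) / 2) (k : ℕ) :
    γ k + ρ⁻¹ / 2 ≤ γ (k + 1) := by
  have h : 2 * γ k ≤ Real.sqrt (ρ⁻¹ ^ 2 + 4 * γ k ^ 2) :=
    Real.le_sqrt_of_sq_le (by nlinarith [sq_nonneg ρ⁻¹])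
  rw [hrec]
  linarith

lemma momentum_monotone (hρ : 0 < ρ)
    (hrec : ∀ k, γ (k + 1) = (ρ⁻¹ + Real.sqrt (ρ⁻¹ ^ 2 + 4 * γ k ^ 2)) / 2) : Monotone γ :=
  monotone_nat_of_le_succ fun k => by
    have := momentum_add_le_succ hrec k
    have : 0 < ρ⁻¹ := inv_pos.2 hρ
    linarith

lemma add_two_mul_le_momentum (hρ : 0 < ρ) (h0 : γ 0 = 0)
    (hrec : ∀ k, γ (k + 1) = (ρ⁻¹ + Real.sqrt (ρ⁻¹ ^ 2 + 4 * γ k ^ 2)) / 2) (k : ℕ) :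
    ((k : ℝ) + 2) * (ρ⁻¹ / 2) ≤ γ (k + 1) := by
  induction k with
  | zero =>
    have : Real.sqrt (ρ⁻¹ ^ 2) = ρ⁻¹ := Real.sqrt_sq (inv_pos.2 hρ).le
    rw [hrec, h0]
    simp only [ne_eq, OfNat.ofNat_ne_zero, not_false_eq_true, zero_pow, mul_zero, add_zero, this]
    push_cast
    linarith
  | succ k ih =>
    have := momentum_add_le_succ hrec (k + 1)
    push_cast
    linarith

end Momentum

lemma agd_rate_of_potential_le {ρ η L γ n X K δ s c ε R : ℝ} (hρ : 0 < ρ) (hL : 0 < L)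
    (hη : η = 1 / (ρ * L)) (hn : 0 < n) (hγ : n * (ρ⁻¹ / 2) ≤ γ) (hK : 0 ≤ K) (hδ : 0 ≤ δ)
    (hε : 0 ≤ ε)
    (h : 2 * (η * ρ) * γ ^ 2 * X ≤ R ^ 2 + n * (2 * (γ * η * δ * K) + 2 * (γ ^ 2 * η ^ 2 * s)
      + γ ^ 2 * η ^ 2 * ρ * c + 2 * (ε * (K ^ 2 / ρ)))) :
    X ≤ 2 * (ρ ^ 2 * L * R ^ 2 / n ^ 2) + n * s / (ρ ^ 2 * L) + 2 * (δ * K)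
      + n * c / (2 * (ρ * L)) + 4 * (ε * (ρ * L * K ^ 2 / n)) := by
  have hγ0 : 0 < γ := lt_of_lt_of_le (by positivity) hγ
  have ht : γ⁻¹ ≤ 2 * ρ / n := by
    rw [inv_le_comm₀ hγ0 (by positivity)]
    calc _ = n * (ρ⁻¹ / 2) := by field_simp
      _ ≤ γ := hγ
  have ht2 : (γ⁻¹) ^ 2 ≤ (2 * ρ / n) ^ 2 := by gcongr
  calc X = L / 2 * γ⁻¹ ^ 2 * (2 * (η * ρ) * γ ^ 2 * X) := by rw [hη]; field_simp
    _ ≤ L / 2 * γ⁻¹ ^ 2 * (R ^ 2 + n * (2 * (γ * η * δ * K) + 2 * (γ ^ 2 * η ^ 2 * s)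
      + γ ^ 2 * η ^ 2 * ρ * c + 2 * (ε * (K ^ 2 / ρ)))) := by gcongr
    _ = L / 2 * R ^ 2 * γ⁻¹ ^ 2 + n * s / (ρ ^ 2 * L) + n * δ * K / ρ * γ⁻¹
        + n * c / (2 * (ρ * L)) + L * n * (ε * (K ^ 2 / ρ)) * γ⁻¹ ^ 2 := by
      rw [hη]; field_simp; ring
    _ ≤ L / 2 * R ^ 2 * (2 * ρ / n) ^ 2 + n * s / (ρ ^ 2 * L) + n * δ * K / ρ * (2 * ρ / n)
        + n * c / (2 * (ρ * L)) + L * n * (ε * (K ^ 2 / ρ)) * (2 * ρ / n) ^ 2 := by gcongr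
    _ = _ := by field_simp; ring

/-- Optimal choice of the damping of the distance term: for `n` steps with bias `δ` in a region of
radius `K` it is `min 1 (n δ / (ρ L K))`. -/
lemma exists_damping {ρ L n δ K : ℝ} (hρ : 1 ≤ ρ) (hL : 0 < L) (hn : 0 < n) (hδ : 0 ≤ δ)
    (hK : 0 ≤ K) :
    ∃ ε c : ℝ, 0 ≤ ε ∧ ε ≤ 1 ∧ 0 ≤ c ∧ 2 * δ ^ 2 ≤ ε * c ∧
      n * c / (2 * (ρ * L)) + 4 * (ε * (ρ * L * K ^ 2 / n)) ≤ 5 * (δ * K) + n * δ ^ 2 / L := by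
  have hρ0 : 0 < ρ := by linarith
  by_cases h : ρ * L * K ≤ n * δ
  · refine ⟨1, 2 * δ ^ 2, zero_le_one, le_rfl, by positivity, by linarith, ?_⟩
    have h1 : n * (2 * δ ^ 2) / (2 * (ρ * L)) ≤ n * δ ^ 2 / L := by
      rw [mul_left_comm, mul_div_mul_left _ _ two_ne_zero]
      gcongr
      exact le_mul_of_one_le_left hL.le hρ
    have h2 : ρ * L * K ^ 2 / n ≤ δ * K := by
      rw [div_le_iff₀ hn]
      nlinarith
    have h3 : 0 ≤ δ * K := by positivity
    linarith
  · push Not at h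
    have hK0 : 0 < K := by
      refine hK.lt_of_ne fun h0 => ?_
      rw [← h0, mul_zero] at h
      exact absurd h (not_lt.2 (by positivity))
    refine ⟨n * δ / (ρ * L * K), 2 * δ * (ρ * L * K) / n, by positivity,
      (div_le_one (by positivity)).2 h.le, by positivity, le_of_eq (by field_simp), ?_⟩
    have h1 : n * (2 * δ * (ρ * L * K) / n) / (2 * (ρ * L)) = δ * K := by field_simp
    have h2 : n * δ / (ρ * L * K) * (ρ * L * K ^ 2 / n) = δ * K := by field_simp
    have h3 : 0 ≤ n * δ ^ 2 / L := by positivity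
    rw [h1, h2]
    linarith

/-- Convergence of Nesterov-accelerated batched SGD with a biased gradient oracle
(Theorem 1 of the paper): for convex `L`-smooth `f`, gradient estimates with
conditional bias at most `δ` and conditional second moment at most
`ρ_B ‖∇f(y_k)‖² + σ²/B` where `ρ_B = max{1, ρ/B}`, step size `η = 1/(ρ_B L)` and
the accelerated parameter sequences, there is an absolute constant `C` with
`E[f(x_N)] - f* ≤ C (ρ_B² L R²/N² + N σ²/(ρ_B² L B) + δ R̃ + N δ²/L)` for all `N ≥ 1`. -/
theorem stmt0 :
    ∃ C : ℝ, 0 < C ∧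
      ∀ (d : ℕ) (Ω : Type) (mΩ : MeasurableSpace Ω) (μ : Measure Ω)
        (_ : IsProbabilityMeasure μ) (ℱ : Filtration ℕ mΩ)
        (f : EuclideanSpace ℝ (Fin d) → ℝ) (L ρ σ2 δ R Rtil ρB η : ℝ) (B : ℕ)
        (xstar : EuclideanSpace ℝ (Fin d)) (fstar : ℝ)
        (x y z g : ℕ → Ω → EuclideanSpace ℝ (Fin d)) (γ a α : ℕ → ℝ),
        0 < L → 0 ≤ ρ → 0 ≤ σ2 → 0 ≤ δ → 1 ≤ B →
        ConvexOn ℝ Set.univ f →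
        Differentiable ℝ f →
        (∀ u v : EuclideanSpace ℝ (Fin d),
          f v ≤ f u + ⟪gradient f u, v - u⟫ + L / 2 * ‖v - u‖ ^ 2) →
        (∀ u, f xstar ≤ f u) → fstar = f xstar →
        ρB = max 1 (ρ / B) →
        η = 1 / (ρB * L) →
        γ 0 = 0 →
        (∀ k, γ (k + 1) = (ρB⁻¹ + Real.sqrt (ρB⁻¹ ^ 2 + 4 * γ k ^ 2)) / 2) →
        (∀ k, a (k + 1) = γ k * Real.sqrt (η * ρB)) →
        (∀ k, α k = γ k * η / (γ k * η + a k ^ 2)) →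
        (∀ ω, x 0 ω = z 0 ω) → (∀ ω, y 0 ω = z 0 ω) →
        (∀ k ω, x (k + 1) ω = y k ω - η • g k ω) →
        (∀ k ω, z (k + 1) ω = z k ω - (γ k * η) • g k ω) →
        (∀ k ω, y (k + 1) ω = α (k + 1) • z (k + 1) ω + (1 - α (k + 1)) • x (k + 1) ω) →
        Adapted ℱ x → Adapted ℱ y → Adapted ℱ z →
        (∀ k, Measurable (g k)) →
        (∀ k, Integrable (g k) μ) →
        (∀ k, Integrable (fun ω => ‖g k ω‖ ^ 2) μ) →
        (∀ k, Integrable (fun ω => f (x k ω)) μ) →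
        (∀ k, ∀ᵐ ω ∂μ, ‖(μ[g k | ℱ k]) ω - gradient f (y k ω)‖ ≤ δ) →
        (∀ k, ∀ᵐ ω ∂μ,
          (μ[(fun ω' => ‖g k ω'‖ ^ 2) | ℱ k]) ω ≤
            ρB * ‖gradient f (y k ω)‖ ^ 2 + σ2 / B) →
        (∀ ω, ‖z 0 ω - xstar‖ = R) →
        (∀ k, ∀ᵐ ω ∂μ, ‖z k ω - xstar‖ ≤ Rtil ∧ ‖z k ω - y k ω‖ ≤ Rtil) →
        ∀ N : ℕ, 1 ≤ N →
          (∫ ω, f (x N ω) ∂μ) - fstar ≤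
            C * (ρB ^ 2 * L * R ^ 2 / N ^ 2 + N * σ2 / (ρB ^ 2 * L * B)
              + δ * Rtil + N * δ ^ 2 / L) := by
  refine ⟨8, by norm_num, ?_⟩
  intro d Ω mΩ μ hμ ℱ f L ρ σ2 δ R Rtil ρB η B xstar fstar x y z g γ a α hL hρ hσ hδ hB hconv hd
    hsmooth hmin hfstar hρB hη hγ0 hγ ha hα hx0 hy0 hx hz hy hxa hya hza hgm hg hg2 hfx hb hV hR hK
    N hN
  subst hfstar
  have hρ1 : 1 ≤ ρB := hρB ▸ le_max_left _ _
  have hρ0 : 0 < ρB := by linarith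
  have hB0 : (0 : ℝ) < B := by exact_mod_cast hB
  have hs : 0 ≤ σ2 / B := by positivity
  have hη0 : 0 < η := by rw [hη]; positivity
  have hηL : η * ρB * L = 1 := by rw [hη]; field_simp
  have hK0 : 0 ≤ Rtil := by
    obtain ⟨ω, hω⟩ := (hK 0).exists
    exact (norm_nonneg _).trans hω.1
  have hfx' : ∀ k, Integrable (fun ω => f (y k ω - η • g k ω)) μ := fun k => by
    simpa only [hx] using hfx (k + 1)
  have hσ_eq : ∀ n : ℝ, n * σ2 / (ρB ^ 2 * L * B) = n * (σ2 / B) / (ρB ^ 2 * L) := fun n => by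
    field_simp
  rw [hσ_eq]
  obtain rfl | ⟨n, rfl⟩ : N = 1 ∨ ∃ n, N = n + 2 := by
    obtain _ | _ | n := N
    · omega
    · exact Or.inl rfl
    · exact Or.inr ⟨n, rfl⟩
  · have hy0R : ∀ᵐ ω ∂μ, ‖y 0 ω - xstar‖ ≤ R := ae_of_all _ fun ω => by rw [hy0, hR]
    have h := integral_gradient_step_sub_min_le (ℱ.le 0) hL hρ1 hηL hd hsmooth hmin (hya 0) (hg 0)
      (hg2 0) (hfx' 0) (hb 0) (hV 0) hy0R
    simp only [← hx, zero_add] at h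
    have h1 : η * (σ2 / B) / (2 * ρB) = (σ2 / B) / (ρB ^ 2 * L) / 2 := by rw [hη]; field_simp
    have h2 : η * δ ^ 2 / 2 ≤ δ ^ 2 / L / 2 := by
      have : η ≤ 1 / L := by
        rw [hη]
        gcongr
        exact le_mul_of_one_le_left hL.le hρ1
      calc η * δ ^ 2 / 2 ≤ 1 / L * δ ^ 2 / 2 := by gcongr
        _ = _ := by ring
    have h3 : L / 2 * R ^ 2 ≤ ρB ^ 2 * L * R ^ 2 / 2 := by
      have := mul_le_mul_of_nonneg_right (one_le_pow₀ hρ1 (n := 2))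
        (by positivity : 0 ≤ L * R ^ 2)
      linarith
    have h4 : 0 ≤ σ2 / B / (ρB ^ 2 * L) := by positivity
    have h5 : 0 ≤ δ ^ 2 / L := by positivity
    have h6 : 0 ≤ ρB ^ 2 * L * R ^ 2 := by positivity
    have h7 : 0 ≤ δ * Rtil := by positivity
    simp only [Nat.cast_one, one_pow, div_one, one_mul]
    linarith
  have hn : (0 : ℝ) < (n : ℝ) + 2 := by positivity
  obtain ⟨ε, c, hε, hε1, hc, hεc, hcost⟩ := exists_damping hρ1 hL hn hδ hK0
  have hγnn := momentum_nonneg hρ0 hγ0 hγ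
  have hγsq := mul_momentum_sq hρ0 hγ
  have hcouple : ∀ k ω, γ (k + 1) • z (k + 1) ω
      = (ρB * γ (k + 1) ^ 2) • y (k + 1) ω - (ρB * γ k ^ 2) • x (k + 1) ω := fun k ω => by
    have hpos : 0 < γ (k + 1) :=
      lt_of_lt_of_le (by positivity) (add_two_mul_le_momentum hρ0 hγ0 hγ k)
    have ha2 : a (k + 1) ^ 2 = γ k ^ 2 * (η * ρB) := by
      rw [ha, mul_pow, Real.sq_sqrt (by positivity)]
    have hden : γ (k + 1) * η + a (k + 1) ^ 2 = ρB * γ (k + 1) ^ 2 * η := by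
      rw [ha2, hγsq]
      ring
    have hα1 : ρB * γ (k + 1) ^ 2 * α (k + 1) = γ (k + 1) := by
      rw [hα, hden]
      field_simp
    have hα2 : ρB * γ (k + 1) ^ 2 * (1 - α (k + 1)) = ρB * γ k ^ 2 := by
      linear_combination hγsq k - hα1
    rw [hy, smul_add, smul_smul, smul_smul, hα1, hα2, add_sub_cancel_right]
  set err : ℝ → ℝ := fun t => 2 * (t * η * δ * Rtil) + 2 * (t ^ 2 * η ^ 2 * (σ2 / B))
    + t ^ 2 * η ^ 2 * ρB * c + 2 * (ε * (Rtil ^ 2 / ρB)) with herr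
  have herr_mono : ∀ k ≤ n + 1, err (γ k) ≤ err (γ (n + 1)) := fun k hk => by
    have h1 : γ k ≤ γ (n + 1) := momentum_monotone hρ0 hγ hk
    have h2 := hγnn k
    simp only [herr]
    gcongr
  have herr0 : 0 ≤ err (γ (n + 1)) := by
    have := hγnn (n + 1)
    simp only [herr]
    positivity
  have hpot : ∀ k ≤ n + 1, 2 * (η * ρB) * γ k ^ 2 * ((∫ ω, f (x (k + 1) ω) ∂μ) - f xstar)
      + (1 - ε) * (∫ ω, ‖z (k + 1) ω - xstar‖ ^ 2 ∂μ) ≤ R ^ 2 + k * err (γ (n + 1)) := by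
    intro k
    induction k with
    | zero =>
      intro _
      have : ∀ ω, ‖z 1 ω - xstar‖ = R := fun ω => by
        rw [← hR ω, ← zero_add 1, hz, hγ0, zero_mul, zero_smul, sub_zero]
      simp only [zero_add, this, hγ0, integral_const, probReal_univ, one_smul, Nat.cast_zero]
      nlinarith [sq_nonneg R]
    | succ k ih =>
      intro hk
      have hstep := agd_potential_step (ℱ.le (k + 1)) hL hρ1 hηL hδ hs (hγnn (k + 1))
        (sq_nonneg (γ k)) (hγsq k) hε hε1 hc hεc hconv hd hsmooth hmin (hya (k + 1)) (hza (k + 1))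
        (hcouple k) (hg (k + 1)) (hg2 (k + 1)) (hfx (k + 1)) (hfx' (k + 1)) (hb (k + 1))
        (hV (k + 1)) (hK (k + 1))
      simp only [← hx, ← hz] at hstep
      have h1 := ih (by omega)
      have h2 := herr_mono (k + 1) hk
      simp only [herr] at h1 h2 ⊢
      push_cast
      linarith
  have hZ : 0 ≤ (1 - ε) * ∫ ω, ‖z (n + 1 + 1) ω - xstar‖ ^ 2 ∂μ :=
    mul_nonneg (by linarith) (integral_nonneg fun ω => by positivity)
  have hfinal := hpot (n + 1) le_rfl
  have hrate := agd_rate_of_potential_le (R := R) (X := (∫ ω, f (x (n + 2) ω) ∂μ) - f xstar)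
    (s := σ2 / B) (c := c) hρ0 hL hη hn
    (add_two_mul_le_momentum hρ0 hγ0 hγ n) hK0 hδ hε (by
      simp only [herr] at hfinal herr0 ⊢
      push_cast at hfinal
      linarith)
  have h1 : 0 ≤ ρB ^ 2 * L * R ^ 2 / ((n : ℝ) + 2) ^ 2 := by positivity
  have h2 : 0 ≤ ((n : ℝ) + 2) * (σ2 / B) / (ρB ^ 2 * L) := by positivity
  have h3 : 0 ≤ ((n : ℝ) + 2) * δ ^ 2 / L := by positivity
  have h4 : 0 ≤ δ * Rtil := by positivity
  push_cast
  linarith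
end

section
/- Let β > 1 and let l be the largest integer strictly less than β. Let f : ℝ^d → ℝ be l times continuously differentiable and suppose that for every unit vector z ∈ ℝ^d, every x ∈ ℝ^d, every r ∈ [−1, 1], every u in the closed unit ball, and every h > 0, the Taylor remainder of the directional derivative satisfies |⟨∇f(x + h r u), z⟩ − ⟨∇f(x), z⟩ − Σ_{1 ≤ |n| ≤ l−1} ((r h)^{|n|}/n!) D^n ⟨∇f(·), z⟩(x) u^n| ≤ (L/((l−1)!)) |r|^{β−1} h^{β−1} ‖u‖^{β−1}. Let K : [−1, 1] → ℝ be a kernel of order l for β, let e be uniform on the unit sphere S^{d−1} and r uniform on [−1, 1], independent, and let g(x, e, r) = (d/(2h))(f(x + h r e) − f(x − h r e)) K(r) e. Then ‖E[g(x, e, r)] − ∇f(x)‖ ≤ κ_β h^{β−1} (L/((l−1)!)) · d/(d + β − 1). -/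
open MeasureTheory Metric
open scoped RealInnerProductSpace

/-- The uniform probability measure on the Euclidean unit sphere
`S^{d-1} = {x : ‖x‖ = 1} ⊆ ℝ^d`, viewed as a measure on `ℝ^d`. -/
noncomputable def sphereUniform (d : ℕ) : Measure (EuclideanSpace ℝ (Fin d)) :=
  (((volume : Measure (EuclideanSpace ℝ (Fin d))).toSphere) Set.univ)⁻¹ •
    Measure.map Subtype.val ((volume : Measure (EuclideanSpace ℝ (Fin d))).toSphere)

/-- The uniform probability measure on the segment `[-1, 1] ⊆ ℝ`. -/
noncomputable def segUniform : Measure ℝ :=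
  (2⁻¹ : ENNReal) • volume.restrict (Set.Icc (-1 : ℝ) 1)

/-- The partial derivative of `f : ℝ^d → ℝ` in the `i`-th coordinate direction. -/
noncomputable def coordDeriv {d : ℕ} (i : Fin d) (f : EuclideanSpace ℝ (Fin d) → ℝ) :
    EuclideanSpace ℝ (Fin d) → ℝ :=
  fun x => fderiv ℝ f x (EuclideanSpace.single i 1)

/-- The iterated partial derivative `D^n f = ∂^{|n|} f / ∂^{n₁}x₁ ⋯ ∂^{n_d}x_d`
associated with a multi-index `n : Fin d → ℕ`. -/
noncomputable def multiDeriv {d : ℕ} (n : Fin d → ℕ) (f : EuclideanSpace ℝ (Fin d) → ℝ) :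
    EuclideanSpace ℝ (Fin d) → ℝ :=
  (List.finRange d).foldr (fun i g => (coordDeriv i)^[n i] g) f

section Polar

variable {E : Type*} [NormedAddCommGroup E] [NormedSpace ℝ E] [MeasurableSpace E] [BorelSpace E]
  [FiniteDimensional ℝ E] [Nontrivial E] (μ : Measure E) [μ.IsAddHaarMeasure]

/-- Integration in polar coordinates. -/
lemma integral_eq_integral_Ioi_toSphere {F : E → ℝ} (hF : Integrable F μ) :
    ∫ x, F x ∂μ = ∫ r in Set.Ioi (0 : ℝ),
      r ^ (Module.finrank ℝ E - 1) * ∫ e : sphere (0 : E) 1, F (r • (e : E)) ∂μ.toSphere := by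
  have mp := μ.measurePreserving_homeomorphUnitSphereProd
  have me := (homeomorphUnitSphereProd E).measurableEmbedding
  let G : sphere (0 : E) 1 × Set.Ioi (0 : ℝ) → ℝ := fun p => F ((p.2 : ℝ) • (p.1 : E))
  have hG : ∀ x : ({0}ᶜ : Set E), G (homeomorphUnitSphereProd E x) = F x := by
    intro x
    simp only [G]
    congr 1
    exact congrArg Subtype.val ((homeomorphUnitSphereProd E).symm_apply_apply x)
  have hGint : Integrable G
      (μ.toSphere.prod (Measure.volumeIoiPow (Module.finrank ℝ E - 1))) := by
    rw [← mp.integrable_comp_emb me]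
    have : G ∘ (homeomorphUnitSphereProd E) = F ∘ (Subtype.val : ({0}ᶜ : Set E) → E) :=
      funext hG
    rw [this, ← integrableOn_iff_comap_subtypeVal (measurableSet_singleton _).compl]
    exact hF.integrableOn
  calc
    ∫ x, F x ∂μ = ∫ x : ({(0)}ᶜ : Set E), F x.1 ∂(μ.comap (↑)) := by
      rw [integral_subtype_comap (measurableSet_singleton _).compl F, restrict_compl_singleton]
    _ = ∫ p, G p ∂(μ.toSphere.prod (Measure.volumeIoiPow (Module.finrank ℝ E - 1))) := by
      rw [← mp.integral_comp me]
      simp only [hG]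
    _ = ∫ r : Set.Ioi (0 : ℝ), ∫ e, F ((r : ℝ) • (e : E)) ∂μ.toSphere
          ∂(Measure.volumeIoiPow (Module.finrank ℝ E - 1)) := integral_prod_symm _ hGint
    _ = _ := by
      simp only [Measure.volumeIoiPow, ENNReal.ofReal]
      rw [integral_withDensity_eq_integral_smul
          ((measurable_subtype_coe.pow_const _).real_toNNReal),
        integral_subtype_comap measurableSet_Ioi
          fun a : ℝ ↦ Real.toNNReal (a ^ (Module.finrank ℝ E - 1)) •
            ∫ e : sphere (0 : E) 1, F (a • (e : E)) ∂μ.toSphere]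
      refine setIntegral_congr_fun measurableSet_Ioi fun x hx ↦ ?_
      simp only [NNReal.smul_def, smul_eq_mul]
      rw [Real.coe_toNNReal _ (pow_nonneg hx.out.le _)]

lemma setIntegral_ball_eq_integral_toSphere {G : E → ℝ} (hG : Continuous G) {q : ℝ → ℝ}
    (hq : Continuous q) {s : ℝ} (hs : 0 < s) :
    ∫ u in ball (0 : E) s, q ‖u‖ * G u ∂μ = ∫ r in (0 : ℝ)..s,
      r ^ (Module.finrank ℝ E - 1) * q r *
        ∫ e : sphere (0 : E) 1, G (r • (e : E)) ∂μ.toSphere := by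
  have hint : IntegrableOn (fun u : E => q ‖u‖ * G u) (ball 0 s) μ :=
    ((by fun_prop : Continuous fun u : E => q ‖u‖ * G u).continuousOn.integrableOn_compact
      (isCompact_closedBall 0 s)).mono_set ball_subset_closedBall
  rw [← integral_indicator measurableSet_ball,
    integral_eq_integral_Ioi_toSphere μ (hint.integrable_indicator measurableSet_ball),
    intervalIntegral.integral_of_le hs.le, integral_Ioc_eq_integral_Ioo]
  refine (setIntegral_eq_of_subset_of_forall_sdiff_eq_zero measurableSet_Ioi
    (Set.Ioo_subset_Ioi_self : Set.Ioo 0 s ⊆ Set.Ioi 0) ?_).trans ?_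
  rotate_left
  · refine setIntegral_congr_fun measurableSet_Ioo fun r hr => ?_
    rw [mul_assoc, ← integral_const_mul (q r)]
    refine congrArg (r ^ (Module.finrank ℝ E - 1) * ·) (integral_congr_ae (.of_forall fun e => ?_))
    have hn : ‖r • (e : E)‖ = r := by simp [norm_smul, abs_of_pos hr.1]
    beta_reduce
    rw [Set.indicator_of_mem (by rw [mem_ball_zero_iff, hn]; exact hr.2), hn]
  · intro r hr
    have hr0 : 0 < r := hr.1
    have : s ≤ r := not_lt.1 fun h => hr.2 ⟨hr0, h⟩
    have h0 : ∀ e : sphere (0 : E) 1,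
        (ball (0 : E) s).indicator (fun u => q ‖u‖ * G u) (r • (e : E)) = 0 := by
      intro e
      refine Set.indicator_of_notMem ?_ _
      have hn : ‖r • (e : E)‖ = r := by simp [norm_smul, abs_of_pos hr0]
      rw [mem_ball_zero_iff, hn]
      exact not_lt.2 this
    simp [h0]

omit [Nontrivial E] in
lemma continuous_integral_toSphere {G : ℝ → E → ℝ} (hG : Continuous G.uncurry) :
    Continuous fun r => ∫ e : sphere (0 : E) 1, G r e ∂μ.toSphere := by
  have : Continuous (Function.uncurry fun (r : ℝ) (e : sphere (0 : E) 1) => G r e) :=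
    hG.comp (continuous_fst.prodMk (continuous_subtype_val.comp continuous_snd))
  simpa using continuous_parametric_integral_of_continuous (μ := μ.toSphere) this isCompact_univ

end Polar

lemma hasDerivAt_max_zero_sq (t : ℝ) :
    HasDerivAt (fun t : ℝ => max t 0 ^ 2) (2 * max t 0) t := by
  rcases lt_trichotomy t 0 with h | h | h
  · have : (fun t : ℝ => max t 0 ^ 2) =ᶠ[nhds t] fun _ => 0 := by
      filter_upwards [gt_mem_nhds h] with a ha
      simp [max_eq_right ha.le]
    rw [max_eq_right h.le, mul_zero]
    exact (hasDerivAt_const t (0 : ℝ)).congr_of_eventuallyEq this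
  · subst h
    rw [hasDerivAt_iff_isLittleO_nhds_zero]
    simp only [zero_add, max_self, mul_zero, smul_zero, sub_zero, ne_eq, OfNat.ofNat_ne_zero,
      not_false_eq_true, zero_pow]
    have h2 : (fun h : ℝ => h ^ 2) =o[nhds 0] fun h => h := by
      simpa using Asymptotics.isLittleO_pow_id (𝕜 := ℝ) one_lt_two
    refine Asymptotics.IsBigO.trans_isLittleO (.of_bound 1 (.of_forall fun h => ?_)) h2
    rw [one_mul, Real.norm_eq_abs, Real.norm_eq_abs, abs_of_nonneg (by positivity),
      abs_of_nonneg (by positivity)]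
    rcases le_total h 0 with h0 | h0
    · simpa [max_eq_right h0] using sq_nonneg h
    · rw [max_eq_left h0]
  · have : (fun t : ℝ => max t 0 ^ 2) =ᶠ[nhds t] fun t => t ^ 2 := by
      filter_upwards [lt_mem_nhds h] with a ha
      simp [max_eq_left ha.le]
    rw [max_eq_left h.le]
    simpa using ((hasDerivAt_pow 2 t).congr_of_eventuallyEq this)

section Divergence

variable {E : Type*} [NormedAddCommGroup E] [InnerProductSpace ℝ E] [MeasurableSpace E]
  [BorelSpace E] [FiniteDimensional ℝ E] (μ : Measure E) [μ.IsAddHaarMeasure]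

lemma integral_ball_weight_mul_fderiv {g : E → ℝ} (hg : ContDiff ℝ 1 g) (z : E) {s : ℝ}
    (hs : 0 < s) :
    ∫ u in ball (0 : E) s, (s ^ 2 - ‖u‖ ^ 2) ^ 2 * fderiv ℝ g u z ∂μ =
      4 * ∫ u in ball (0 : E) s, (s ^ 2 - ‖u‖ ^ 2) * (g u * ⟪u, z⟫) ∂μ := by
  let w : E → ℝ := fun u => max (s ^ 2 - ‖u‖ ^ 2) 0 ^ 2
  have hw : ∀ u, HasFDerivAt w ((2 * max (s ^ 2 - ‖u‖ ^ 2) 0) • (-((2 : ℝ) • innerSL ℝ u))) u := by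
    intro u
    have h1 : HasFDerivAt (fun u : E => s ^ 2 - ‖u‖ ^ 2) (-((2 : ℝ) • innerSL ℝ u)) u := by
      simpa [two_smul] using (hasStrictFDerivAt_norm_sq u).hasFDerivAt.const_sub (s ^ 2)
    exact (hasDerivAt_max_zero_sq (s ^ 2 - ‖u‖ ^ 2)).comp_hasFDerivAt u h1
  have hwz : ∀ u, fderiv ℝ w u z = -(4 * (max (s ^ 2 - ‖u‖ ^ 2) 0 * ⟪u, z⟫)) := by
    intro u
    rw [(hw u).fderiv]
    simp
    ring
  have hout : ∀ u : E, u ∉ ball (0 : E) s → max (s ^ 2 - ‖u‖ ^ 2) 0 = 0 := by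
    intro u hu
    have hu' : s ≤ ‖u‖ := by simpa using hu
    exact max_eq_right (by nlinarith)
  have hin : ∀ u ∈ ball (0 : E) s, max (s ^ 2 - ‖u‖ ^ 2) 0 = s ^ 2 - ‖u‖ ^ 2 := by
    intro u hu
    have hu' : ‖u‖ < s := by simpa using hu
    exact max_eq_left (by nlinarith [norm_nonneg u])
  have hsupp : ∀ F : E → ℝ, Continuous F → (∀ u ∉ ball (0 : E) s, F u = 0) → Integrable F μ := by
    intro F hF h0
    refine hF.integrable_of_hasCompactSupport
      (HasCompactSupport.intro (isCompact_closedBall (0 : E) s) fun u hu => h0 u fun h => ?_)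
    exact hu (ball_subset_closedBall h)
  have hgc : Continuous g := hg.continuous
  have hg'c : Continuous fun u => fderiv ℝ g u z :=
    (hg.continuous_fderiv one_ne_zero).clm_apply continuous_const
  have hwc : Continuous w := by fun_prop
  have hw'c : Continuous fun u => fderiv ℝ w u z := by
    simp only [hwz]
    fun_prop
  have key := integral_mul_fderiv_eq_neg_fderiv_mul_of_integrable (μ := μ) (f := w) (g := g)
    (v := z)
    (hsupp _ (hw'c.mul hgc) fun u hu => by simp [hwz, hout u hu])
    (hsupp _ (hwc.mul hg'c) fun u hu => by simp [w, hout u hu])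
    (hsupp _ (hwc.mul hgc) fun u hu => by simp [w, hout u hu])
    (fun u _ => (hw u).differentiableAt) (fun u _ => hg.differentiable one_ne_zero u)
  rw [← integral_neg, ← setIntegral_eq_integral_of_forall_compl_eq_zero (s := ball (0 : E) s)
      (f := fun u => w u * fderiv ℝ g u z) (fun u hu => by simp [w, hout u hu]),
    ← setIntegral_eq_integral_of_forall_compl_eq_zero (s := ball (0 : E) s)
      (f := fun u => -(fderiv ℝ w u z * g u)) (fun u hu => by simp [hwz, hout u hu])] at key
  rw [← integral_const_mul]
  refine Eq.trans (setIntegral_congr_fun measurableSet_ball fun u hu => ?_)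
    (key.trans (setIntegral_congr_fun measurableSet_ball fun u hu => ?_))
  · simp only [w, hin u hu]
  · simp only [hwz, hin u hu]
    ring

/-- The divergence theorem on the unit ball, for the vector field `g • z`. -/
theorem integral_toSphere_mul_inner [Nontrivial E] {g : E → ℝ} (hg : ContDiff ℝ 1 g) (z : E) :
    ∫ e : sphere (0 : E) 1, g e * ⟪(e : E), z⟫ ∂μ.toSphere =
      ∫ u in ball (0 : E) 1, fderiv ℝ g u z ∂μ := by
  set n := Module.finrank ℝ E - 1
  have hgc : Continuous g := hg.continuous
  have hg'c : Continuous fun u => fderiv ℝ g u z :=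
    (hg.continuous_fderiv one_ne_zero).clm_apply continuous_const
  set A : ℝ → ℝ := fun r => ∫ e : sphere (0 : E) 1, fderiv ℝ g (r • (e : E)) z ∂μ.toSphere with hA
  set B : ℝ → ℝ := fun r => ∫ e : sphere (0 : E) 1, g (r • (e : E)) * ⟪(e : E), z⟫ ∂μ.toSphere
    with hB
  have hAc : Continuous A := continuous_integral_toSphere μ
    (G := fun r e => fderiv ℝ g (r • e) z) (hg'c.comp (by fun_prop))
  have hBc : Continuous B := continuous_integral_toSphere μ
    (G := fun r e => g (r • e) * ⟪e, z⟫) (by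
      simp only [Function.uncurry_def]; fun_prop)
  let m : ℕ → ℝ → ℝ := fun k s => ∫ r in (0 : ℝ)..s, r ^ (n + k) * A r
  let p : ℕ → ℝ → ℝ := fun k s => ∫ r in (0 : ℝ)..s, r ^ (n + k) * (r * B r)
  have hm : ∀ k s, HasDerivAt (m k) (s ^ (n + k) * A s) s := fun k s =>
    ((continuous_pow _).mul hAc).integral_hasStrictDerivAt 0 s |>.hasDerivAt
  have hp : ∀ k s, HasDerivAt (p k) (s ^ (n + k) * (s * B s)) s := fun k s =>
    ((continuous_pow _).mul (continuous_id.mul hBc)).integral_hasStrictDerivAt 0 s |>.hasDerivAt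
  have hmi : ∀ k s, IntervalIntegrable (fun r => r ^ (n + k) * A r) volume 0 s := fun k s =>
    ((continuous_pow _).mul hAc).intervalIntegrable _ _
  have hpi : ∀ k s, IntervalIntegrable (fun r => r ^ (n + k) * (r * B r)) volume 0 s := fun k s =>
    ((continuous_pow _).mul (continuous_id.mul hBc)).intervalIntegrable _ _
  have quad : ∀ s, 0 < s → s ^ 4 * m 0 s - 2 * s ^ 2 * m 2 s + m 4 s =
      4 * (s ^ 2 * p 0 s - p 2 s) := by
    intro s hs
    have h := integral_ball_weight_mul_fderiv μ hg z hs
    rw [setIntegral_ball_eq_integral_toSphere μ hg'c (q := fun r => (s ^ 2 - r ^ 2) ^ 2)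
        (by fun_prop) hs,
      setIntegral_ball_eq_integral_toSphere μ (G := fun u => g u * ⟪u, z⟫) (by fun_prop)
        (q := fun r => s ^ 2 - r ^ 2) (by fun_prop) hs] at h
    have hG : ∀ r : ℝ, ∫ e : sphere (0 : E) 1, g (r • (e : E)) * ⟪r • (e : E), z⟫ ∂μ.toSphere
        = r * B r := by
      intro r
      rw [hB, ← integral_const_mul]
      congr 1 with e
      rw [real_inner_smul_left]
      ring
    simp only [hG] at h
    simp only [m, p]
    rw [← intervalIntegral.integral_const_mul, ← intervalIntegral.integral_const_mul,
      ← intervalIntegral.integral_const_mul, ← intervalIntegral.integral_sub,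
      ← intervalIntegral.integral_add, ← intervalIntegral.integral_sub]
    · refine Eq.trans (intervalIntegral.integral_congr fun r _ => ?_)
        (h.trans (congrArg _ (intervalIntegral.integral_congr fun r _ => ?_)))
      · change _ = r ^ n * _ * A r
        ring
      · change r ^ n * _ * _ = _
        ring
    · exact (hpi 0 s).const_mul _
    · exact hpi 2 s
    · exact ((hmi 0 s).const_mul _).sub ((hmi 2 s).const_mul _)
    · exact hmi 4 s
    · exact (hmi 0 s).const_mul _
    · exact (hmi 2 s).const_mul _
  have lin : ∀ s, 0 < s → s ^ 2 * m 0 s - m 2 s = 2 * p 0 s := by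
    intro s hs
    have h1 := (((hasDerivAt_pow 4 s).mul (hm 0 s)).sub
      (((hasDerivAt_pow 2 s).const_mul 2).mul (hm 2 s))).add (hm 4 s)
    have h2 := (((hasDerivAt_pow 2 s).mul (hp 0 s)).sub (hp 2 s)).const_mul 4
    have h3 := h1.unique (h2.congr_of_eventuallyEq (by
      filter_upwards [lt_mem_nhds hs] with t ht
      exact quad t ht))
    have h4 : 4 * s * (s ^ 2 * m 0 s - m 2 s - 2 * p 0 s) = 0 := by
      push_cast at h3
      linear_combination h3
    have := (mul_eq_zero.1 h4).resolve_left (by positivity)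
    linarith
  have h1 := ((hasDerivAt_pow 2 (1 : ℝ)).mul (hm 0 1)).sub (hm 2 1)
  have h2 := (hp 0 1).const_mul 2
  have h3 := h1.unique (h2.congr_of_eventuallyEq (by
    filter_upwards [lt_mem_nhds one_pos] with t ht
    exact lin t ht))
  have h4 : B 1 = m 0 1 := by
    simp at h3
    linarith
  have h5 := setIntegral_ball_eq_integral_toSphere μ hg'c (q := fun _ => 1) (by fun_prop) one_pos
  simp only [one_mul, mul_one] at h5
  rw [h5]
  simpa [hB, m] using h4

/-- The mean value of `‖u‖ ^ a` over the unit ball, unnormalized. -/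
lemma integral_ball_norm_rpow [Nontrivial E] {a : ℝ} (ha : 0 < a) :
    ∫ u in ball (0 : E) 1, ‖u‖ ^ a ∂μ =
      μ.real (ball (0 : E) 1) * (Module.finrank ℝ E / (Module.finrank ℝ E + a)) := by
  have hn : 0 < Module.finrank ℝ E := Module.finrank_pos
  have h := setIntegral_ball_eq_integral_toSphere μ (E := E) (G := fun _ => 1) (by fun_prop)
    (q := fun r => |r| ^ a) (by
      exact continuous_abs.rpow_const fun _ => Or.inr ha.le) one_pos
  simp only [mul_one, abs_norm, integral_const, smul_eq_mul, Measure.toSphere_real_apply_univ,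
    intervalIntegral.integral_mul_const] at h
  have h2 : ∫ r in (0 : ℝ)..1, r ^ (Module.finrank ℝ E - 1) * |r| ^ a =
      ∫ r in (0 : ℝ)..1, r ^ ((Module.finrank ℝ E : ℝ) - 1 + a) := by
    rw [intervalIntegral.integral_of_le zero_le_one, intervalIntegral.integral_of_le zero_le_one]
    refine setIntegral_congr_fun measurableSet_Ioc fun r hr => ?_
    rw [abs_of_pos hr.1, Real.rpow_add hr.1, ← Real.rpow_natCast, Nat.cast_pred hn]
  have hn1 : (1 : ℝ) ≤ Module.finrank ℝ E := by exact_mod_cast hn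
  rw [h, h2, integral_rpow (Or.inl (by linarith)), Real.one_rpow,
    Real.zero_rpow (by linarith)]
  have : (Module.finrank ℝ E : ℝ) - 1 + a + 1 = Module.finrank ℝ E + a := by ring
  rw [this]
  ring

end Divergence

lemma norm_le_of_forall_inner_le {E : Type*} [NormedAddCommGroup E] [InnerProductSpace ℝ E]
    {v : E} {C : ℝ} (hC : 0 ≤ C) (h : ∀ z : E, ‖z‖ = 1 → ⟪v, z⟫ ≤ C) : ‖v‖ ≤ C := by
  rcases eq_or_ne v 0 with rfl | hv
  · simpa using hC
  · have hv' : ‖v‖ ≠ 0 := norm_ne_zero_iff.2 hv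
    have := h (‖v‖⁻¹ • v) (by rw [norm_smul, norm_inv, norm_norm, inv_mul_cancel₀ hv'])
    rwa [real_inner_smul_right, real_inner_self_eq_norm_sq, sq, inv_mul_cancel_left₀ hv'] at this

section Uniform

variable (d : ℕ)

lemma integral_segUniform (F : ℝ → ℝ) :
    ∫ r, F r ∂segUniform = (1 / 2 : ℝ) * ∫ r in (-1 : ℝ)..1, F r := by
  rw [segUniform, integral_smul_measure, intervalIntegral.integral_of_le (by norm_num),
    integral_Icc_eq_integral_Ioc]
  simp

lemma integrable_segUniform_iff {F : ℝ → ℝ} :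
    Integrable F segUniform ↔ IntervalIntegrable F volume (-1) 1 := by
  rw [segUniform, integrable_smul_measure (by simp) (by simp),
    intervalIntegrable_iff_integrableOn_Icc_of_le (by norm_num), IntegrableOn]

lemma ae_segUniform_mem_Icc : ∀ᵐ r ∂segUniform, r ∈ Set.Icc (-1 : ℝ) 1 :=
  Measure.ae_smul_measure (ae_restrict_mem measurableSet_Icc) _

instance : IsFiniteMeasure segUniform :=
  Measure.smul_finite _ (by simp)

lemma ae_sphereUniform_norm_eq_one : ∀ᵐ e ∂(sphereUniform d), ‖e‖ = 1 := by
  refine Measure.ae_smul_measure ?_ _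
  rw [ae_map_iff measurable_subtype_coe.aemeasurable
    (measurableSet_eq_fun measurable_norm measurable_const)]
  exact .of_forall fun e => norm_eq_of_mem_sphere e

variable {d}

lemma nontrivial_euclideanSpace (hd : 1 ≤ d) : Nontrivial (EuclideanSpace ℝ (Fin d)) := by
  have : Nonempty (Fin d) := Fin.pos_iff_nonempty.1 hd
  infer_instance

lemma isFiniteMeasure_sphereUniform (hd : 1 ≤ d) : IsFiniteMeasure (sphereUniform d) := by
  have := nontrivial_euclideanSpace hd
  refine Measure.smul_finite _ (ENNReal.inv_ne_top.2 ?_)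
  rw [Ne, Measure.measure_univ_eq_zero]
  exact Measure.toSphere_ne_zero _

lemma integral_sphereUniform (F : EuclideanSpace ℝ (Fin d) → ℝ) :
    ∫ e, F e ∂(sphereUniform d) =
      (d * volume.real (ball (0 : EuclideanSpace ℝ (Fin d)) 1))⁻¹ *
        ∫ e : sphere (0 : EuclideanSpace ℝ (Fin d)) 1, F e ∂volume.toSphere := by
  rw [sphereUniform, integral_smul_measure,
    (MeasurableEmbedding.subtype_coe isClosed_sphere.measurableSet).integral_map,
    ENNReal.toReal_inv, ← measureReal_def, Measure.toSphere_real_apply_univ,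
    finrank_euclideanSpace_fin, smul_eq_mul]

lemma inner_gradient {f : EuclideanSpace ℝ (Fin d) → ℝ} (y z : EuclideanSpace ℝ (Fin d)) :
    ⟪gradient f y, z⟫ = fderiv ℝ f y z := by
  simp [gradient]

lemma continuous_gradient {f : EuclideanSpace ℝ (Fin d) → ℝ} (hf : ContDiff ℝ 1 f) :
    Continuous (gradient f) :=
  (LinearIsometryEquiv.continuous _).comp (hf.continuous_fderiv one_ne_zero)

/-- Averaging `f` over a sphere against a linear form averages its gradient over the ball. -/
lemma integral_sphereUniform_mul_inner (hd : 1 ≤ d) {f : EuclideanSpace ℝ (Fin d) → ℝ}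
    (hf : ContDiff ℝ 1 f) (x z : EuclideanSpace ℝ (Fin d)) (c : ℝ) :
    ∫ e, f (x + c • e) * ⟪e, z⟫ ∂(sphereUniform d) =
      (d * volume.real (ball (0 : EuclideanSpace ℝ (Fin d)) 1))⁻¹ *
        (c * ∫ u in ball (0 : EuclideanSpace ℝ (Fin d)) 1, ⟪gradient f (x + c • u), z⟫) := by
  have := nontrivial_euclideanSpace hd
  have hg : ContDiff ℝ 1 fun y => f (x + c • y) := by fun_prop
  rw [integral_sphereUniform, integral_toSphere_mul_inner volume hg z, ← integral_const_mul c]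
  refine congrArg _ (integral_congr_ae (.of_forall fun u => ?_))
  have h1 : HasFDerivAt (fun y : EuclideanSpace ℝ (Fin d) => x + c • y)
      (c • ContinuousLinearMap.id ℝ (EuclideanSpace ℝ (Fin d))) u :=
    ((hasFDerivAt_id u).const_smul c).const_add x
  have h2 := ((hf.differentiable one_ne_zero (x + c • u)).hasFDerivAt.comp u h1).fderiv
  beta_reduce
  rw [inner_gradient]
  change fderiv ℝ (f ∘ fun y => x + c • y) u z = _
  rw [h2]
  simp

end Uniform

/-- A kernel of order `l` recovers the linear coefficient of a function which is, up to an error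
`M * |r| ^ β`, a polynomial of degree at most `l` without constant term. -/
lemma abs_kernel_integral_sub_le {K H : ℝ → ℝ} {l : ℕ} {β a M : ℝ} (C : ℕ → ℝ)
    (hKint : IntervalIntegrable K volume (-1) 1)
    (hK1 : (1 / 2 : ℝ) * ∫ u in (-1 : ℝ)..1, u * K u = 1)
    (hKj : ∀ j : ℕ, 2 ≤ j → j ≤ l → (1 / 2 : ℝ) * ∫ u in (-1 : ℝ)..1, u ^ j * K u = 0)
    (hKβint : IntervalIntegrable (fun u => |u| ^ β * |K u|) volume (-1) 1)
    (hHK : IntervalIntegrable (fun r => H r * K r) volume (-1) 1)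
    (hH : ∀ r ∈ Set.Icc (-1 : ℝ) 1,
      |H r - (r * a + ∑ j ∈ Finset.Icc 1 (l - 1), C j * r ^ (j + 1))| ≤ M * |r| ^ β) :
    |(1 / 2 : ℝ) * (∫ r in (-1 : ℝ)..1, H r * K r) - a| ≤
      1 / 2 * (M * ∫ u in (-1 : ℝ)..1, |u| ^ β * |K u|) := by
  have hpow : ∀ j : ℕ, IntervalIntegrable (fun r => r ^ j * K r) volume (-1) 1 := fun j =>
    hKint.continuousOn_mul (continuous_pow j).continuousOn
  have h1 : IntervalIntegrable (fun r => r * K r) volume (-1) 1 := by simpa using hpow 1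
  have hsum : IntervalIntegrable
      (fun r => ∑ j ∈ Finset.Icc 1 (l - 1), C j * (r ^ (j + 1) * K r)) volume (-1) 1 := by
    simpa only [Finset.sum_fn] using IntervalIntegrable.sum (Finset.Icc 1 (l - 1))
      fun j _ => (hpow (j + 1)).const_mul (C j)
  have heq : (1 / 2 : ℝ) * (∫ r in (-1 : ℝ)..1, H r * K r) - a = (1 / 2 : ℝ) *
      ∫ r in (-1 : ℝ)..1,
        (H r - (r * a + ∑ j ∈ Finset.Icc 1 (l - 1), C j * r ^ (j + 1))) * K r := by
    have hz : ∀ j ∈ Finset.Icc 1 (l - 1), C j * ∫ r in (-1 : ℝ)..1, r ^ (j + 1) * K r = 0 := by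
      intro j hj
      rw [Finset.mem_Icc] at hj
      have := hKj (j + 1) (by omega) (by omega)
      rw [(by linarith : ∫ r in (-1 : ℝ)..1, r ^ (j + 1) * K r = 0), mul_zero]
    have hrw : (fun r => (H r - (r * a + ∑ j ∈ Finset.Icc 1 (l - 1), C j * r ^ (j + 1))) * K r) =
        fun r => H r * K r -
          (a * (r * K r) + ∑ j ∈ Finset.Icc 1 (l - 1), C j * (r ^ (j + 1) * K r)) := by
      ext r
      rw [sub_mul, add_mul, Finset.sum_mul]
      congr 2
      · ring
      · exact Finset.sum_congr rfl fun j _ => by ring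
    rw [hrw, intervalIntegral.integral_sub hHK ((h1.const_mul a).add hsum),
      intervalIntegral.integral_add (h1.const_mul a) hsum, intervalIntegral.integral_const_mul,
      intervalIntegral.integral_finsetSum fun j _ => (hpow (j + 1)).const_mul (C j)]
    simp only [intervalIntegral.integral_const_mul]
    rw [Finset.sum_eq_zero hz]
    linear_combination a * hK1
  rw [heq, abs_mul, abs_of_pos (by norm_num : (0 : ℝ) < 1 / 2),
    ← intervalIntegral.integral_const_mul]
  refine mul_le_mul_of_nonneg_left ?_ (by norm_num)
  rw [← Real.norm_eq_abs]
  refine intervalIntegral.norm_integral_le_of_norm_le (by norm_num) (.of_forall fun r hr => ?_)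
    (hKβint.const_mul M)
  rw [norm_mul, Real.norm_eq_abs, Real.norm_eq_abs, ← mul_assoc]
  exact mul_le_mul_of_nonneg_right (hH r (Set.Ioc_subset_Icc_self hr)) (abs_nonneg _)

/-- A function within `B * ‖u‖ ^ a` of a constant plus a continuous function has ball average
within `B * d / (d + a)` of the average of the latter. -/
lemma abs_ball_average_sub_le {d : ℕ} (hd : 1 ≤ d) {a B c : ℝ} (ha : 0 < a)
    {F P : EuclideanSpace ℝ (Fin d) → ℝ} (hF : Continuous F) (hP : Continuous P)
    (hFP : ∀ u, ‖u‖ ≤ 1 → |F u - c - P u| ≤ B * ‖u‖ ^ a) :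
    |(volume.real (ball (0 : EuclideanSpace ℝ (Fin d)) 1))⁻¹ *
        (∫ u in ball (0 : EuclideanSpace ℝ (Fin d)) 1, F u) - c -
      (volume.real (ball (0 : EuclideanSpace ℝ (Fin d)) 1))⁻¹ *
        ∫ u in ball (0 : EuclideanSpace ℝ (Fin d)) 1, P u| ≤ B * (d / (d + a)) := by
  have := nontrivial_euclideanSpace hd
  set V := volume.real (ball (0 : EuclideanSpace ℝ (Fin d)) 1) with hV
  have hV0 : 0 < V := by
    rw [hV, measureReal_def]
    exact ENNReal.toReal_pos (isOpen_ball.measure_ne_zero _ (by simp)) measure_ball_lt_top.ne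
  have hint : ∀ G : EuclideanSpace ℝ (Fin d) → ℝ, Continuous G →
      IntegrableOn G (ball 0 1) volume := fun G hG =>
    (hG.continuousOn.integrableOn_compact (isCompact_closedBall 0 1)).mono_set
      ball_subset_closedBall
  have heq : V⁻¹ * (∫ u in ball (0 : EuclideanSpace ℝ (Fin d)) 1, F u) - c -
      V⁻¹ * ∫ u in ball (0 : EuclideanSpace ℝ (Fin d)) 1, P u =
      V⁻¹ * ∫ u in ball (0 : EuclideanSpace ℝ (Fin d)) 1, (F u - c - P u) := by
    rw [integral_sub (f := fun u => F u - c) (hint _ (hF.sub continuous_const)) (hint _ hP),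
      integral_sub (hint _ hF) (hint _ continuous_const), setIntegral_const, smul_eq_mul, ← hV]
    field_simp
  have hnorm : Continuous fun u : EuclideanSpace ℝ (Fin d) => B * ‖u‖ ^ a :=
    continuous_const.mul (continuous_norm.rpow_const fun _ => Or.inr ha.le)
  have hle : ‖∫ u in ball (0 : EuclideanSpace ℝ (Fin d)) 1, (F u - c - P u)‖ ≤
      ∫ u in ball (0 : EuclideanSpace ℝ (Fin d)) 1, B * ‖u‖ ^ a :=
    norm_integral_le_of_norm_le (hint _ hnorm) <| by
      filter_upwards [ae_restrict_mem measurableSet_ball] with u hu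
      exact hFP u (mem_ball_zero_iff.1 hu).le
  rw [integral_const_mul, integral_ball_norm_rpow volume ha, finrank_euclideanSpace_fin] at hle
  rw [heq, abs_mul, abs_of_pos (inv_pos.2 hV0)]
  calc V⁻¹ * |∫ u in ball (0 : EuclideanSpace ℝ (Fin d)) 1, (F u - c - P u)|
      ≤ V⁻¹ * (B * (V * (d / (d + a)))) :=
        mul_le_mul_of_nonneg_left hle (inv_pos.2 hV0).le
    _ = B * (d / (d + a)) := by field_simp

/-- The kernel estimator is integrable for the product of the two uniform laws. -/
lemma integrable_kernel_estimator {d : ℕ} (hd : 1 ≤ d) {f : EuclideanSpace ℝ (Fin d) → ℝ}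
    (hf : Continuous f) {K : ℝ → ℝ} (hKmeas : Measurable K)
    (hKint : IntervalIntegrable K volume (-1) 1) (x : EuclideanSpace ℝ (Fin d)) (a h : ℝ) :
    Integrable (fun p : EuclideanSpace ℝ (Fin d) × ℝ =>
      (a * (f (x + (h * p.2) • p.1) - f (x - (h * p.2) • p.1)) * K p.2) • p.1)
      ((sphereUniform d).prod segUniform) := by
  have := isFiniteMeasure_sphereUniform hd
  let A : EuclideanSpace ℝ (Fin d) × ℝ → ℝ := fun p =>
    a * (f (x + (h * p.2) • p.1) - f (x - (h * p.2) • p.1))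
  have hA : Continuous A := by fun_prop
  obtain ⟨B, hB⟩ := ((isCompact_closedBall (0 : EuclideanSpace ℝ (Fin d)) 1).prod
    (isCompact_Icc (a := (-1 : ℝ)) (b := 1))).exists_bound_of_continuousOn hA.continuousOn
  have hK : Integrable (fun p : EuclideanSpace ℝ (Fin d) × ℝ => B * |K p.2|)
      ((sphereUniform d).prod segUniform) :=
    (((integrable_segUniform_iff.2 hKint).comp_snd (sphereUniform d)).abs).const_mul B
  refine hK.mono' ?_ ?_
  · exact ((hA.measurable.mul (hKmeas.comp measurable_snd)).smul
      measurable_fst).aestronglyMeasurable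
  · filter_upwards [Measure.quasiMeasurePreserving_fst.ae (ae_sphereUniform_norm_eq_one d),
      Measure.quasiMeasurePreserving_snd.ae ae_segUniform_mem_Icc] with p h1 h2
    rw [norm_smul, h1, mul_one, norm_mul, Real.norm_eq_abs (K p.2)]
    exact mul_le_mul_of_nonneg_right (hB p ⟨by simp [h1], h2⟩) (abs_nonneg _)

/-- Bias bound for the kernel gradient approximation under higher-order smoothness:
if `f` is `l` times continuously differentiable (with `l` the largest integer `< β`),
its directional-derivative Taylor remainders are bounded as in Hölder-smoothness of
order `β`, and `K` is a kernel of order `l` for `β`, then the kernel estimator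
`g(x, e, r) = (d/(2h))(f(x + h r e) - f(x - h r e)) K(r) e` with `e` uniform on the
unit sphere and `r` uniform on `[-1, 1]`, independent, satisfies
`‖E[g(x, e, r)] - ∇f(x)‖ ≤ κ_β h^{β-1} (L/((l-1)!)) · d/(d + β - 1)`. -/
theorem stmt9 (d : ℕ) (hd : 1 ≤ d) (β L : ℝ) (hβ : 1 < β) (hL : 0 < L)
    (l : ℕ) (hl1 : (l : ℝ) < β) (hl2 : β ≤ l + 1)
    (f : EuclideanSpace ℝ (Fin d) → ℝ) (hf : ContDiff ℝ l f)
    (htaylor : ∀ z : EuclideanSpace ℝ (Fin d), ‖z‖ = 1 →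
      ∀ x : EuclideanSpace ℝ (Fin d), ∀ r ∈ Set.Icc (-1 : ℝ) 1,
      ∀ u : EuclideanSpace ℝ (Fin d), ‖u‖ ≤ 1 → ∀ h : ℝ, 0 < h →
      |⟪gradient f (x + (h * r) • u), z⟫ - ⟪gradient f x, z⟫ -
          ∑ j ∈ Finset.Icc 1 (l - 1), ∑ n ∈ Finset.Nat.antidiagonalTuple d j,
            (r * h) ^ j / (∏ i, (Nat.factorial (n i) : ℝ)) *
              multiDeriv n (fun w => ⟪gradient f w, z⟫) x * ∏ i, u i ^ n i| ≤
        L / (Nat.factorial (l - 1) : ℝ) * |r| ^ (β - 1) * h ^ (β - 1) * ‖u‖ ^ (β - 1))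
    (K : ℝ → ℝ) (hKmeas : Measurable K)
    (hKint : IntervalIntegrable K volume (-1) 1)
    (hK0 : (1 / 2 : ℝ) * ∫ u in (-1 : ℝ)..1, K u = 0)
    (hK1 : (1 / 2 : ℝ) * ∫ u in (-1 : ℝ)..1, u * K u = 1)
    (hKj : ∀ j : ℕ, 2 ≤ j → j ≤ l → (1 / 2 : ℝ) * ∫ u in (-1 : ℝ)..1, u ^ j * K u = 0)
    (hKβint : IntervalIntegrable (fun u => |u| ^ β * |K u|) volume (-1) 1)
    (κβ : ℝ) (hκβ : κβ = ∫ u in (-1 : ℝ)..1, |u| ^ β * |K u|)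
    (x : EuclideanSpace ℝ (Fin d)) (h : ℝ) (hh : 0 < h) :
    ‖(∫ e, ∫ r,
        (((d : ℝ) / (2 * h)) * (f (x + (h * r) • e) - f (x - (h * r) • e)) * K r) • e
        ∂segUniform ∂(sphereUniform d)) - gradient f x‖ ≤
      κβ * h ^ (β - 1) * (L / (Nat.factorial (l - 1) : ℝ)) * (d / (d + β - 1)) := by
  have hl0 : 1 ≤ l := by
    by_contra hl
    have : l = 0 := by omega
    subst this
    norm_num at hl2
    linarith
  have hf1 : ContDiff ℝ 1 f := hf.of_le (by exact_mod_cast hl0)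
  have hd0 : (0 : ℝ) < d := by exact_mod_cast hd
  have := isFiniteMeasure_sphereUniform hd
  set V := volume.real (ball (0 : EuclideanSpace ℝ (Fin d)) 1) with hV
  have hV0 : 0 < V := by
    rw [hV, measureReal_def]
    exact ENNReal.toReal_pos (isOpen_ball.measure_ne_zero _ (by simp)) measure_ball_lt_top.ne
  set M := L / (Nat.factorial (l - 1) : ℝ) * h ^ (β - 1) * (d / (d + (β - 1))) with hM
  have hM0 : 0 ≤ M := by
    have : 0 < β - 1 := by linarith
    positivity
  have hκ0 : 0 ≤ κβ := by
    rw [hκβ]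
    exact intervalIntegral.integral_nonneg (by norm_num) fun u _ => by positivity
  have hκM : κβ * h ^ (β - 1) * (L / (Nat.factorial (l - 1) : ℝ)) * (d / (d + β - 1)) =
      κβ * M := by
    rw [hM, ← add_sub_assoc]
    ring
  rw [hκM]
  have hΦ := integrable_kernel_estimator hd hf1.continuous hKmeas hKint x ((d : ℝ) / (2 * h)) h
  rw [← integral_prod _ hΦ]
  refine norm_le_of_forall_inner_le (by positivity) fun z hz => ?_
  have hcoef := htaylor z hz x
  let D : ℝ → ℝ := fun r =>
    V⁻¹ * ∫ u in ball (0 : EuclideanSpace ℝ (Fin d)) 1, ⟪gradient f (x + (h * r) • u), z⟫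
  let H : ℝ → ℝ := fun r =>
    ∫ e, (d : ℝ) / (2 * h) * (f (x + (h * r) • e) - f (x - (h * r) • e)) * ⟪e, z⟫
      ∂(sphereUniform d)
  let Q : ℕ → EuclideanSpace ℝ (Fin d) → ℝ := fun j u =>
    ∑ n ∈ Finset.Nat.antidiagonalTuple d j, h ^ j / (∏ i, (Nat.factorial (n i) : ℝ)) *
      multiDeriv n (fun w => ⟪gradient f w, z⟫) x * ∏ i, u i ^ n i
  have hQ : ∀ j, Continuous (Q j) := fun j => by fun_prop
  let C : ℕ → ℝ := fun j => V⁻¹ * ∫ u in ball (0 : EuclideanSpace ℝ (Fin d)) 1, Q j u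
  have hint : ∀ G : EuclideanSpace ℝ (Fin d) → ℝ, Continuous G →
      IntegrableOn G (ball 0 1) volume := fun G hG =>
    (hG.continuousOn.integrableOn_compact (isCompact_closedBall 0 1)).mono_set
      ball_subset_closedBall
  have hgrad := continuous_gradient hf1
  have hD : ∀ r ∈ Set.Icc (-1 : ℝ) 1,
      |D r - ⟪gradient f x, z⟫ - ∑ j ∈ Finset.Icc 1 (l - 1), C j * r ^ j| ≤
        M * |r| ^ (β - 1) := by
    intro r hr
    have key := abs_ball_average_sub_le hd (a := β - 1) (c := ⟪gradient f x, z⟫)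
      (B := L / (Nat.factorial (l - 1) : ℝ) * |r| ^ (β - 1) * h ^ (β - 1))
      (F := fun u => ⟪gradient f (x + (h * r) • u), z⟫)
      (P := fun u => ∑ j ∈ Finset.Icc 1 (l - 1), r ^ j * Q j u) (by linarith)
      (by fun_prop) (by fun_prop) (fun u hu => by
        refine le_of_eq_of_le ?_ (hcoef r hr u hu h hh)
        congr 2
        refine Finset.sum_congr rfl fun j _ => ?_
        simp only [Q]
        rw [Finset.mul_sum]
        refine Finset.sum_congr rfl fun n _ => ?_
        rw [mul_pow]
        ring)
    rw [← hV, integral_finsetSum _ fun j _ => (hint _ (hQ j)).const_mul (r ^ j),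
      Finset.mul_sum] at key
    refine le_of_eq_of_le ?_ (key.trans_eq ?_)
    · congr 2
      refine Finset.sum_congr rfl fun j _ => ?_
      simp only [C]
      rw [integral_const_mul]
      ring
    · rw [hM]
      ring
  have hHD : ∀ r, H r = r * ((D r + D (-r)) / 2) := by
    intro r
    have hcont : ∀ c : ℝ, Integrable (fun e => f (x + c • e) * ⟪e, z⟫) (sphereUniform d) := by
      intro c
      have hc : Continuous fun e : EuclideanSpace ℝ (Fin d) => f (x + c • e) * ⟪e, z⟫ := by
        have := hf1.continuous
        fun_prop
      obtain ⟨B, hB⟩ := (isCompact_closedBall (0 : EuclideanSpace ℝ (Fin d)) 1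
        ).exists_bound_of_continuousOn hc.continuousOn
      refine (integrable_const B).mono' hc.aestronglyMeasurable ?_
      filter_upwards [ae_sphereUniform_norm_eq_one d] with e he
      exact hB e (by simp [he])
    have hsplit : H r = (d : ℝ) / (2 * h) *
        ((∫ e, f (x + (h * r) • e) * ⟪e, z⟫ ∂(sphereUniform d)) -
          ∫ e, f (x + (h * -r) • e) * ⟪e, z⟫ ∂(sphereUniform d)) := by
      rw [← integral_sub (hcont _) (hcont _), ← integral_const_mul]
      refine integral_congr_ae (.of_forall fun e => ?_)
      simp only [mul_neg, neg_smul, ← sub_eq_add_neg]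
      ring
    rw [hsplit, integral_sphereUniform_mul_inner hd hf1,
      integral_sphereUniform_mul_inner hd hf1, ← hV]
    simp only [D]
    field_simp
    ring
  let C' : ℕ → ℝ := fun j => C j * ((1 + (-1) ^ j) / 2)
  have hH : ∀ r ∈ Set.Icc (-1 : ℝ) 1,
      |H r - (r * ⟪gradient f x, z⟫ + ∑ j ∈ Finset.Icc 1 (l - 1), C' j * r ^ (j + 1))| ≤
        M * |r| ^ β := by
    intro r hr
    have h1 := hD r hr
    have h2 := hD (-r) ⟨by linarith [hr.2], by linarith [hr.1]⟩
    rw [abs_neg] at h2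
    have hsum : ∑ j ∈ Finset.Icc 1 (l - 1), C' j * r ^ (j + 1) =
        r * ((∑ j ∈ Finset.Icc 1 (l - 1), C j * r ^ j +
          ∑ j ∈ Finset.Icc 1 (l - 1), C j * (-r) ^ j) / 2) := by
      rw [← Finset.sum_add_distrib, Finset.sum_div, Finset.mul_sum]
      refine Finset.sum_congr rfl fun j _ => ?_
      simp only [C']
      rw [neg_pow r]
      ring
    have hpow : |r| ^ β = |r| * |r| ^ (β - 1) := by
      have := Real.rpow_add_one' (abs_nonneg r) (y := β - 1) (by linarith)
      rw [sub_add_cancel] at this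
      rw [this, mul_comm]
    have heq : H r - (r * ⟪gradient f x, z⟫ + ∑ j ∈ Finset.Icc 1 (l - 1), C' j * r ^ (j + 1)) =
        r * (((D r - ⟪gradient f x, z⟫ - ∑ j ∈ Finset.Icc 1 (l - 1), C j * r ^ j) +
          (D (-r) - ⟪gradient f x, z⟫ - ∑ j ∈ Finset.Icc 1 (l - 1), C j * (-r) ^ j)) / 2) := by
      rw [hHD, hsum]
      ring
    rw [heq, abs_mul, hpow, mul_left_comm]
    refine mul_le_mul_of_nonneg_left ?_ (abs_nonneg r)
    rw [abs_le] at h1 h2 ⊢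
    constructor <;> linarith [h1.1, h1.2, h2.1, h2.2]
  have hΦz := hΦ.inner_const (𝕜 := ℝ) z
  have hHKeq : ∀ r, ∫ e, ⟪(((d : ℝ) / (2 * h)) *
      (f (x + (h * r) • e) - f (x - (h * r) • e)) * K r) • e, z⟫ ∂(sphereUniform d) =
        H r * K r := by
    intro r
    rw [← integral_mul_const]
    refine integral_congr_ae (.of_forall fun e => ?_)
    simp only
    rw [real_inner_smul_left]
    ring
  have hHK : IntervalIntegrable (fun r => H r * K r) volume (-1) 1 := by
    rw [← integrable_segUniform_iff]
    simpa only [hHKeq] using hΦz.integral_prod_right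
  have hbias := abs_kernel_integral_sub_le C' hKint hK1 hKj hKβint hHK hH
  have hmean : ⟪∫ p : EuclideanSpace ℝ (Fin d) × ℝ, (((d : ℝ) / (2 * h)) *
      (f (x + (h * p.2) • p.1) - f (x - (h * p.2) • p.1)) * K p.2) • p.1
        ∂((sphereUniform d).prod segUniform), z⟫ =
      (1 / 2 : ℝ) * ∫ r in (-1 : ℝ)..1, H r * K r := by
    rw [real_inner_comm, ← integral_inner hΦ, ← integral_segUniform]
    simp only [real_inner_comm _ z]
    rw [integral_prod_symm _ hΦz]
    simp only [hHKeq]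
  rw [inner_sub_left, hmean]
  rw [← hκβ] at hbias
  have := mul_nonneg hκ0 hM0
  linarith [le_of_abs_le hbias]
end

section
/- Let f : ℝ^d → ℝ be continuously differentiable, x ∈ ℝ^d, h > 0. If e is uniformly distributed on the unit sphere S^{d−1} ⊂ ℝ^d and u is uniformly distributed on the closed unit ball B^d ⊂ ℝ^d, then (d/h) E[f(x + h e) e] = E[∇f(x + h u)]. -/
open MeasureTheory Metric
open scoped RealInnerProductSpace

/-- The uniform probability measure on the closed Euclidean unit ball of `ℝ^d`. -/
noncomputable def ballUniform (d : ℕ) : Measure (EuclideanSpace ℝ (Fin d)) :=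
  (volume (closedBall (0 : EuclideanSpace ℝ (Fin d)) 1))⁻¹ •
    volume.restrict (closedBall (0 : EuclideanSpace ℝ (Fin d)) 1)

open Set Filter Topology

section

variable {E : Type*} [NormedAddCommGroup E] [InnerProductSpace ℝ E] [FiniteDimensional ℝ E]
  [MeasurableSpace E] [BorelSpace E]

/-- Integration in polar coordinates. -/
theorem integral_polar_toSphere [Nontrivial E] (μ : Measure E) [μ.IsAddHaarMeasure] {F : E → ℝ}
    (hF : Integrable F μ) :
    ∫ y, F y ∂μ =
      ∫ r in Ioi (0 : ℝ), r ^ (Module.finrank ℝ E - 1) * ∫ e, F (r • e.1) ∂μ.toSphere := by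
  have hmp := μ.measurePreserving_homeomorphUnitSphereProd
  have hemb := (homeomorphUnitSphereProd E).measurableEmbedding
  set G : sphere (0 : E) 1 × Ioi (0 : ℝ) → ℝ := fun p ↦ F (p.2.1 • p.1.1) with hG
  have hGF : G ∘ homeomorphUnitSphereProd E = F ∘ Subtype.val := by
    ext y
    have := congrArg Subtype.val ((homeomorphUnitSphereProd E).symm_apply_apply y)
    rw [homeomorphUnitSphereProd_symm_apply_coe] at this
    simp only [hG, Function.comp_apply, this]
  have hint : Integrable G
      (μ.toSphere.prod (Measure.volumeIoiPow (Module.finrank ℝ E - 1))) := by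
    rw [← hmp.integrable_comp_emb hemb, hGF,
      ← integrableOn_iff_comap_subtypeVal (measurableSet_singleton _).compl]
    exact hF.integrableOn
  calc
    ∫ y, F y ∂μ = ∫ y : ({(0)}ᶜ : Set E), F y.1 ∂(μ.comap (↑)) := by
      rw [integral_subtype_comap (measurableSet_singleton _).compl fun y ↦ F y,
        restrict_compl_singleton]
    _ = ∫ p, G p ∂μ.toSphere.prod (.volumeIoiPow (Module.finrank ℝ E - 1)) := by
      rw [← hmp.integral_comp hemb]
      exact integral_congr_ae (.of_forall fun y ↦ (congrFun hGF y).symm)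
    _ = ∫ r : Ioi (0 : ℝ), ∫ e, F (r.1 • e.1) ∂μ.toSphere
          ∂.volumeIoiPow (Module.finrank ℝ E - 1) := integral_prod_symm _ hint
    _ = _ := by
      simp only [Measure.volumeIoiPow, ENNReal.ofReal]
      rw [integral_withDensity_eq_integral_smul
          ((measurable_subtype_coe.pow_const _).real_toNNReal),
        integral_subtype_comap measurableSet_Ioi fun r : ℝ ↦
          Real.toNNReal (r ^ (Module.finrank ℝ E - 1)) • ∫ e, F (r • e.1) ∂μ.toSphere]
      refine setIntegral_congr_fun measurableSet_Ioi fun r hr ↦ ?_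
      simp only [NNReal.smul_def, Real.coe_toNNReal _ (pow_nonneg (le_of_lt hr) _), smul_eq_mul]

/-- The flux, through the sphere of radius `r`, of the field `g • v`. -/
noncomputable def radialFlux (μ : Measure E) (g : E → ℝ) (v : E) (r : ℝ) : ℝ :=
  r ^ (Module.finrank ℝ E - 1) * ∫ e, g (r • e.1) * ⟪e.1, v⟫ ∂μ.toSphere

theorem continuous_radialFlux (μ : Measure E) [μ.IsAddHaarMeasure] {g : E → ℝ}
    (hg : Continuous g) (v : E) : Continuous (radialFlux μ g v) := by
  refine (continuous_pow _).mul ?_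
  have := continuous_parametric_integral_of_continuous (μ := μ.toSphere)
    (f := fun (r : ℝ) (e : sphere (0 : E) 1) ↦ g (r • e.1) * ⟪e.1, v⟫)
    (by unfold Function.uncurry; fun_prop) isCompact_univ
  simpa using this

theorem integral_radial_mul_fderiv [Nontrivial E] (μ : Measure E) [μ.IsAddHaarMeasure]
    {g : E → ℝ} (hg : ContDiff ℝ 1 g) (v : E) {χ : ℝ → ℝ} (hχ : ContDiff ℝ 1 χ)
    (hχ0 : ∀ s, 4 ≤ s → χ s = 0) :
    ∫ y, χ (‖y‖ ^ 2) * fderiv ℝ g y v ∂μ =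
      ∫ r in Ioc (0 : ℝ) 2, (-(2 * r * deriv χ (r ^ 2))) * radialFlux μ g v r := by
  set ρ : E → ℝ := fun y ↦ χ (‖y‖ ^ 2) with hρ
  have hρc : ContDiff ℝ 1 ρ := hχ.comp (contDiff_norm_sq ℝ)
  have hρd (y : E) : fderiv ℝ ρ y v = 2 * deriv χ (‖y‖ ^ 2) * ⟪y, v⟫ := by
    have h1 : HasFDerivAt ρ _ y :=
      ((hχ.differentiable one_ne_zero _).hasDerivAt.comp_hasFDerivAt y
        (hasStrictFDerivAt_norm_sq y).hasFDerivAt)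
    rw [h1.fderiv]
    simp
    ring
  have hρs : HasCompactSupport ρ := by
    refine HasCompactSupport.intro (isCompact_closedBall (0 : E) 2) fun y hy ↦ hχ0 _ ?_
    have : 2 < ‖y‖ := by simpa using hy
    nlinarith
  have hρ's : HasCompactSupport fun y ↦ fderiv ℝ ρ y v := hρs.fderiv_apply ℝ v
  have hρ'c : Continuous fun y ↦ fderiv ℝ ρ y v := by
    have := hρc.continuous_fderiv one_ne_zero
    fun_prop
  have hg'c : Continuous fun y ↦ fderiv ℝ g y v := by
    have := hg.continuous_fderiv one_ne_zero
    fun_prop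
  have hint : Integrable (fun y ↦ fderiv ℝ ρ y v * g y) μ :=
    (hρ'c.mul hg.continuous).integrable_of_hasCompactSupport hρ's.mul_right
  have hχ'0 (r : ℝ) (hr : 2 < r) : deriv χ (r ^ 2) = 0 := by
    have : χ =ᶠ[𝓝 (r ^ 2)] fun _ ↦ 0 := by
      filter_upwards [lt_mem_nhds (show 4 < r ^ 2 by nlinarith)] with s hs using hχ0 s hs.le
    rw [this.deriv_eq, deriv_const]
  rw [integral_mul_fderiv_eq_neg_fderiv_mul_of_integrable hint
    ((hρc.continuous.mul hg'c).integrable_of_hasCompactSupport hρs.mul_right)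
    ((hρc.continuous.mul hg.continuous).integrable_of_hasCompactSupport hρs.mul_right)
    (fun y _ ↦ hρc.differentiable one_ne_zero y) (fun y _ ↦ hg.differentiable one_ne_zero y),
    integral_polar_toSphere μ hint, ← integral_neg]
  have hpolar (r : ℝ) : -(r ^ (Module.finrank ℝ E - 1) *
      ∫ e, fderiv ℝ ρ (r • e.1) v * g (r • e.1) ∂μ.toSphere) =
      (-(2 * r * deriv χ (r ^ 2))) * radialFlux μ g v r := by
    have (e : sphere (0 : E) 1) : fderiv ℝ ρ (r • e.1) v * g (r • e.1) =
        (2 * r * deriv χ (r ^ 2)) * (g (r • e.1) * ⟪e.1, v⟫) := by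
      rw [hρd, norm_smul, norm_eq_of_mem_sphere e, mul_one, Real.norm_eq_abs, sq_abs,
        real_inner_smul_left]
      ring
    simp only [this]
    rw [integral_const_mul, radialFlux]
    ring
  simp only [hpolar]
  refine setIntegral_eq_of_subset_of_forall_sdiff_eq_zero measurableSet_Ioi
    Ioc_subset_Ioi_self fun r hr ↦ ?_
  have hr2 : 2 < r := by
    by_contra! h
    exact hr.2 ⟨hr.1, h⟩
  rw [hχ'0 r hr2]
  ring

theorem integral_closedBall_fderiv_eq_radialFlux [Nontrivial E] (μ : Measure E)
    [μ.IsAddHaarMeasure] {g : E → ℝ} (hg : ContDiff ℝ 1 g) (v : E) :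
    ∫ y in closedBall (0 : E) 1, fderiv ℝ g y v ∂μ = ∫ e, g e.1 * ⟪e.1, v⟫ ∂μ.toSphere := by
  set χ : ℕ → ℝ → ℝ := fun n s ↦ Real.smoothTransition (1 + (n + 1) * (1 - s)) with hχdef
  have hχ (n) : ContDiff ℝ 1 (χ n) :=
    Real.smoothTransition.contDiff.comp (by fun_prop)
  have hχanti (n) : Antitone (χ n) := fun s t hst ↦ by
    apply Real.smoothTransition.monotone
    have : (0 : ℝ) ≤ n + 1 := by positivity
    nlinarith
  have hχ1 (n) (s : ℝ) (hs : s ≤ 1) : χ n s = 1 := by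
    apply Real.smoothTransition.one_of_one_le
    have : (0 : ℝ) ≤ n + 1 := by positivity
    nlinarith
  have hχ0 (n : ℕ) (s : ℝ) (hs : 1 ≤ (n + 1) * (s - 1)) : χ n s = 0 := by
    apply Real.smoothTransition.zero_of_nonpos
    linarith
  have hχ4 (n : ℕ) (s : ℝ) (hs : 4 ≤ s) : χ n s = 0 := by
    apply hχ0
    have : (0 : ℝ) ≤ n := by positivity
    nlinarith
  have hχev (δ : ℝ) (hδ : 1 < δ) : ∀ᶠ n : ℕ in atTop, ∀ s, δ ≤ s → χ n s = 0 := by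
    filter_upwards [(tendsto_natCast_atTop_atTop (R := ℝ)).eventually_ge_atTop ((1 : ℝ) / (δ - 1))]
      with n hn s hs
    apply hχ0
    rw [div_le_iff₀ (by linarith)] at hn
    have : (0 : ℝ) ≤ n := by positivity
    nlinarith
  have hg'c : Continuous fun y ↦ fderiv ℝ g y v := by
    have := hg.continuous_fderiv one_ne_zero
    fun_prop
  have hleft : Tendsto (fun n ↦ ∫ y, χ n (‖y‖ ^ 2) * fderiv ℝ g y v ∂μ) atTop
      (𝓝 (∫ y in closedBall (0 : E) 1, fderiv ℝ g y v ∂μ)) := by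
    rw [← integral_indicator measurableSet_closedBall]
    refine tendsto_integral_of_dominated_convergence
      ((closedBall (0 : E) 2).indicator fun y ↦ ‖fderiv ℝ g y v‖) (fun n ↦ ?_) ?_ (fun n ↦ ?_) ?_
    · have := (hχ n).continuous
      exact Continuous.aestronglyMeasurable (by fun_prop)
    · rw [integrable_indicator_iff measurableSet_closedBall]
      exact hg'c.norm.continuousOn.integrableOn_compact (isCompact_closedBall _ _)
    · refine .of_forall fun y ↦ ?_
      by_cases hy : y ∈ closedBall (0 : E) 2
      · rw [indicator_of_mem hy, norm_mul, Real.norm_of_nonneg (Real.smoothTransition.nonneg _)]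
        exact mul_le_of_le_one_left (norm_nonneg _) (Real.smoothTransition.le_one _)
      · rw [indicator_of_notMem hy, hχ4, zero_mul, norm_zero]
        have : 2 < ‖y‖ := by simpa using hy
        nlinarith
    · refine .of_forall fun y ↦ tendsto_const_nhds.congr' ?_
      by_cases hy : y ∈ closedBall (0 : E) 1
      · refine .of_forall fun n ↦ ?_
        have : ‖y‖ ≤ 1 := by simpa using hy
        simp only [indicator_of_mem hy]
        rw [hχ1 n _ (by nlinarith [norm_nonneg y]), one_mul]
      · have : 1 < ‖y‖ := by simpa using hy
        filter_upwards [hχev (‖y‖ ^ 2) (by nlinarith)] with n hn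
        rw [indicator_of_notMem hy, hn _ le_rfl, zero_mul]
  have hder (n) (r : ℝ) : HasDerivAt (fun r ↦ -χ n (r ^ 2)) (-(2 * r * deriv (χ n) (r ^ 2))) r := by
    have := ((hχ n).differentiable one_ne_zero (r ^ 2)).hasDerivAt.comp r (hasDerivAt_pow 2 r)
    exact this.neg.congr_deriv (by push_cast; ring)
  have hcont (n) : Continuous fun r : ℝ ↦ -(2 * r * deriv (χ n) (r ^ 2)) := by
    have := (hχ n).continuous_deriv le_rfl
    fun_prop
  have hK := continuous_radialFlux μ hg.continuous v
  have hright : Tendsto (fun n ↦ ∫ r in Ioc (0 : ℝ) 2,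
      (-(2 * r * deriv (χ n) (r ^ 2))) • radialFlux μ g v r) atTop (𝓝 (radialFlux μ g v 1)) := by
    refine tendsto_setIntegral_peak_smul_of_integrableOn_of_tendsto (x₀ := 1) measurableSet_Ioc
      measurableSet_Ioc subset_rfl self_mem_nhdsWithin (by simp) (.of_forall fun n r hr ↦ ?_)
      (fun u hu h1u ↦ ?_) ?_ (.of_forall fun n ↦ (hcont n).aestronglyMeasurable)
      (hK.integrableOn_Ioc) (hK.tendsto 1 |>.mono_left nhdsWithin_le_nhds)
    · have := (hχanti n).deriv_nonpos (x := r ^ 2)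
      nlinarith [hr.1, mul_nonneg hr.1.le (neg_nonneg.2 this)]
    · obtain ⟨ε, hε, hεu⟩ := Metric.isOpen_iff.1 hu 1 h1u
      rw [Metric.tendstoUniformlyOn_iff]
      intro η hη
      filter_upwards [hχev (1 + ε / 2) (by linarith)] with n hn r hr
      suffices deriv (χ n) (r ^ 2) = 0 by simpa [this] using hη
      have hr1 : r ∉ ball (1 : ℝ) ε := fun h ↦ hr.2 (hεu h)
      have hr0 : 0 < r := hr.1.1
      rw [mem_ball, Real.dist_eq, not_lt, le_abs] at hr1
      rcases hr1 with h | h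
      · have : χ n =ᶠ[𝓝 (r ^ 2)] fun _ ↦ 0 := by
          filter_upwards [lt_mem_nhds (show 1 + ε / 2 < r ^ 2 by nlinarith)] with s hs
            using hn s hs.le
        rw [this.deriv_eq, deriv_const]
      · have : χ n =ᶠ[𝓝 (r ^ 2)] fun _ ↦ 1 := by
          filter_upwards [gt_mem_nhds (show r ^ 2 < 1 by nlinarith)] with s hs
            using hχ1 n s hs.le
        rw [this.deriv_eq, deriv_const]
    · refine tendsto_const_nhds.congr fun n ↦ ?_
      rw [← intervalIntegral.integral_of_le zero_le_two,
        intervalIntegral.integral_eq_sub_of_hasDerivAt (fun r _ ↦ hder n r)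
          ((hcont n).intervalIntegrable _ _), hχ4 n _ (by norm_num), hχ1 n _ (by norm_num)]
      norm_num
  have heq := tendsto_nhds_unique (hleft.congr fun n ↦
    integral_radial_mul_fderiv μ hg v (hχ n) (hχ4 n)) hright
  simpa [radialFlux] using heq

/-- The divergence theorem on the unit ball, for gradients. -/
theorem integral_closedBall_gradient_eq_integral_toSphere [Nontrivial E] (μ : Measure E)
    [μ.IsAddHaarMeasure] {g : E → ℝ} (hg : ContDiff ℝ 1 g) :
    ∫ y in closedBall (0 : E) 1, gradient g y ∂μ = ∫ e, g e.1 • e.1 ∂μ.toSphere := by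
  have hgc := hg.continuous
  have hgr : Continuous (gradient g) :=
    (InnerProductSpace.toDual ℝ E).symm.continuous.comp (hg.continuous_fderiv one_ne_zero)
  have h1 : IntegrableOn (gradient g) (closedBall (0 : E) 1) μ :=
    hgr.continuousOn.integrableOn_compact (isCompact_closedBall _ _)
  have h2 : Integrable (fun e : sphere (0 : E) 1 ↦ g e.1 • e.1) μ.toSphere :=
    Continuous.integrable_of_hasCompactSupport (by fun_prop) (.of_compactSpace _)
  refine ext_inner_left ℝ fun v ↦ ?_
  rw [← integral_inner h1, ← integral_inner h2]
  simp only [gradient, real_inner_smul_left, ← real_inner_comm v,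
    InnerProductSpace.toDual_symm_apply]
  exact integral_closedBall_fderiv_eq_radialFlux μ hg v

end

/-- Sphere-to-ball version of Stokes' theorem: for continuously differentiable
`f : ℝ^d → ℝ`, `x ∈ ℝ^d`, `h > 0`, with `e` uniform on the unit sphere and
`u` uniform on the closed unit ball, `(d/h) E[f(x + h e) e] = E[∇f(x + h u)]`. -/
theorem stmt10 (d : ℕ) (hd : 1 ≤ d) (f : EuclideanSpace ℝ (Fin d) → ℝ)
    (hf : ContDiff ℝ 1 f) (x : EuclideanSpace ℝ (Fin d)) (h : ℝ) (hh : 0 < h) :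
    ((d : ℝ) / h) • (∫ e, f (x + h • e) • e ∂(sphereUniform d)) =
      ∫ u, gradient f (x + h • u) ∂(ballUniform d) := by
  have : Nonempty (Fin d) := ⟨⟨0, hd⟩⟩
  have hg : ContDiff ℝ 1 fun u ↦ f (x + h • u) := hf.comp (by fun_prop)
  have hgrad (u : EuclideanSpace ℝ (Fin d)) :
      gradient (fun u ↦ f (x + h • u)) u = h • gradient f (x + h • u) := by
    have h1 : HasFDerivAt (fun u : EuclideanSpace ℝ (Fin d) ↦ x + h • u)
        (h • ContinuousLinearMap.id ℝ _) u := ((hasFDerivAt_id u).const_smul h).const_add x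
    have h2 := (hf.differentiable one_ne_zero (x + h • u)).hasFDerivAt.comp u h1
    have h3 : fderiv ℝ (fun u ↦ f (x + h • u)) u = h • fderiv ℝ f (x + h • u) := by
      rw [← Function.comp_def f, h2.fderiv]
      simp
    simp [gradient, h3]
  have hmain := integral_closedBall_gradient_eq_integral_toSphere
    (volume : Measure (EuclideanSpace ℝ (Fin d))) hg
  simp only [hgrad] at hmain
  rw [integral_smul] at hmain
  rw [sphereUniform, ballUniform, integral_smul_measure, integral_smul_measure,
    (MeasurableEmbedding.subtype_coe isClosed_sphere.measurableSet).integral_map, ← hmain,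
    Measure.toSphere_apply_univ, Measure.addHaar_closedBall_eq_addHaar_ball, smul_smul, smul_smul]
  congr 1
  have hd0 : (d : ℝ) ≠ 0 := by positivity
  rw [finrank_euclideanSpace_fin, ENNReal.toReal_inv, ENNReal.toReal_inv, ENNReal.toReal_mul,
    ENNReal.toReal_natCast, mul_inv]
  field_simp
end

section
/- Let f : ℝ^d → ℝ be l times differentiable at x, let e be uniformly distributed on the unit sphere S^{d−1} (so that E[e eᵀ] = (1/d) I_d), let r be a real random variable independent of e with E[r K(r)] = 1 and E[r^{|n|} K(r)] = 0 for all multi-indices n with 2 ≤ |n| ≤ l, and let h > 0. Then E[(d/h)(⟨∇f(x), h r e⟩ + Σ_{2 ≤ |n| ≤ l} ((r h)^{|n|}/n!) D^n f(x) e^n) K(r) e] = ∇f(x), where D^n f(x) e^n = (∂^{|n|} f(x)/∂^{n₁}x₁ ⋯ ∂^{n_d}x_d) e₁^{n₁} ⋯ e_d^{n_d}. -/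
open MeasureTheory Metric
open scoped RealInnerProductSpace

/-- The surface measure of the unit sphere is invariant under linear isometries. -/
theorem map_toSphere_map_linearIsometryEquiv {d : ℕ}
    (L : EuclideanSpace ℝ (Fin d) ≃ₗᵢ[ℝ] EuclideanSpace ℝ (Fin d)) :
    Measure.map L (Measure.map Subtype.val
        ((volume : Measure (EuclideanSpace ℝ (Fin d))).toSphere)) =
      Measure.map Subtype.val ((volume : Measure (EuclideanSpace ℝ (Fin d))).toSphere) := by
  ext A hA
  have hL : Measurable L := L.continuous.measurable
  have hv : Measurable (Subtype.val : sphere (0 : EuclideanSpace ℝ (Fin d)) 1 → _) :=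
    measurable_subtype_coe
  rw [Measure.map_apply hL hA, Measure.map_apply hv (hL hA), Measure.map_apply hv hA,
    Measure.toSphere_apply' _ (hv (hL hA)), Measure.toSphere_apply' _ (hv hA)]
  congr 1
  symm
  rw [← L.measurePreserving.measure_preimage_emb L.toHomeomorph.measurableEmbedding]
  congr 1
  ext y
  simp only [Set.mem_preimage, Set.mem_smul, Subtype.image_preimage_coe, Set.mem_inter_iff,
    mem_sphere_zero_iff_norm]
  constructor
  · rintro ⟨t, ht, z, ⟨hz, hzA⟩, hty⟩
    refine ⟨t, ht, L.symm z, ⟨by simpa using hz, by simpa using hzA⟩, ?_⟩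
    rw [← map_smul, hty, L.symm_apply_apply]
  · rintro ⟨t, ht, z, ⟨hz, hzA⟩, rfl⟩
    exact ⟨t, ht, L z, ⟨by simpa using hz, hzA⟩, by simp⟩

theorem map_sphereUniform_linearIsometryEquiv {d : ℕ}
    (L : EuclideanSpace ℝ (Fin d) ≃ₗᵢ[ℝ] EuclideanSpace ℝ (Fin d)) :
    Measure.map L (sphereUniform d) = sphereUniform d := by
  rw [sphereUniform, Measure.map_smul, map_toSphere_map_linearIsometryEquiv]

theorem isProbabilityMeasure_sphereUniform {d : ℕ} (hd : 1 ≤ d) :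
    IsProbabilityMeasure (sphereUniform d) := by
  have : NeZero d := ⟨by omega⟩
  constructor
  rw [sphereUniform, Measure.smul_apply, Measure.map_apply measurable_subtype_coe .univ,
    Set.preimage_univ, smul_eq_mul]
  refine ENNReal.inv_mul_cancel ?_ (measure_ne_top _ _)
  rw [Measure.measure_univ_ne_zero]
  exact Measure.toSphere_ne_zero _

theorem ae_norm_eq_one_sphereUniform (d : ℕ) : ∀ᵐ e ∂(sphereUniform d), ‖e‖ = 1 := by
  refine Measure.ae_smul_measure ?_ _
  rw [ae_map_iff measurable_subtype_coe.aemeasurable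
    (isClosed_eq continuous_norm continuous_const).measurableSet]
  exact .of_forall fun e => by simp

theorem integrable_inner_mul_inner_sphereUniform {d : ℕ} (hd : 1 ≤ d)
    (u v : EuclideanSpace ℝ (Fin d)) :
    Integrable (fun e => ⟪u, e⟫ * ⟪v, e⟫) (sphereUniform d) := by
  have := isProbabilityMeasure_sphereUniform hd
  refine Integrable.of_bound (by fun_prop) (‖u‖ * ‖v‖) ?_
  filter_upwards [ae_norm_eq_one_sphereUniform d] with e he
  rw [norm_mul]
  refine mul_le_mul ?_ ?_ (norm_nonneg _) (norm_nonneg _)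
  · simpa [he] using norm_inner_le_norm (𝕜 := ℝ) u e
  · simpa [he] using norm_inner_le_norm (𝕜 := ℝ) v e

theorem integral_inner_mul_self_sphereUniform_congr {d : ℕ}
    {u v : EuclideanSpace ℝ (Fin d)} (huv : ‖u‖ = ‖v‖) :
    ∫ e, ⟪u, e⟫ * ⟪u, e⟫ ∂(sphereUniform d) = ∫ e, ⟪v, e⟫ * ⟪v, e⟫ ∂(sphereUniform d) := by
  set L := (ℝ ∙ (u - v))ᗮ.reflection
  have hL : L u = v := Submodule.reflection_sub huv
  conv_rhs => rw [← map_sphereUniform_linearIsometryEquiv L]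
  rw [integral_map L.continuous.measurable.aemeasurable (by fun_prop)]
  simp_rw [← hL, LinearIsometryEquiv.inner_map_map]

theorem integral_inner_mul_inner_sphereUniform_of_inner_eq_zero {d : ℕ} (hd : 1 ≤ d)
    {u v : EuclideanSpace ℝ (Fin d)} (huv : ⟪u, v⟫ = 0) :
    ∫ e, ⟪u, e⟫ * ⟪v, e⟫ ∂(sphereUniform d) = 0 := by
  have hn : ‖u + v‖ = ‖u - v‖ := by
    rw [← sq_eq_sq₀ (norm_nonneg _) (norm_nonneg _), norm_add_sq_real, norm_sub_sq_real, huv]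
    ring
  have h1 := integral_inner_mul_self_sphereUniform_congr hn
  have hI := integrable_inner_mul_inner_sphereUniform hd
  rw [← sub_eq_zero, ← integral_sub (hI _ _) (hI _ _)] at h1
  have h2 : ∀ e : EuclideanSpace ℝ (Fin d),
      ⟪u + v, e⟫ * ⟪u + v, e⟫ - ⟪u - v, e⟫ * ⟪u - v, e⟫ = 4 * (⟪u, e⟫ * ⟪v, e⟫) := fun e => by
    rw [inner_add_left, inner_sub_left]; ring
  simp_rw [h2] at h1
  rw [integral_const_mul] at h1
  linarith

theorem integral_coord_mul_coord_sphereUniform {d : ℕ} (hd : 1 ≤ d) (i j : Fin d) :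
    ∫ e, e i * e j ∂(sphereUniform d) = if i = j then (d : ℝ)⁻¹ else 0 := by
  have := isProbabilityMeasure_sphereUniform hd
  have hs : ∀ (k : Fin d) (e : EuclideanSpace ℝ (Fin d)),
      ⟪EuclideanSpace.single k (1 : ℝ), e⟫ = e k := fun k e => by
    simp [EuclideanSpace.inner_single_left]
  split_ifs with hij
  · subst hij
    have hall : ∀ k, ∫ e, e k * e k ∂(sphereUniform d) = ∫ e, e i * e i ∂(sphereUniform d) := by
      intro k
      have := integral_inner_mul_self_sphereUniform_congr
        (u := EuclideanSpace.single k (1 : ℝ)) (v := EuclideanSpace.single i (1 : ℝ)) (by simp)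
      simpa only [hs] using this
    have hsum : ∑ k, ∫ e, e k * e k ∂(sphereUniform d) = 1 := by
      rw [← integral_finsetSum]
      · calc _ = ∫ _, (1 : ℝ) ∂(sphereUniform d) := by
              refine integral_congr_ae ?_
              filter_upwards [ae_norm_eq_one_sphereUniform d] with e he
              have := EuclideanSpace.real_norm_sq_eq e
              rw [he] at this
              simp only [← pow_two]
              linarith
          _ = 1 := by simp
      · intro k _
        simpa only [hs] using integrable_inner_mul_inner_sphereUniform hd
          (EuclideanSpace.single k 1) (EuclideanSpace.single k 1)
    simp only [hall, Finset.sum_const, Finset.card_univ, Fintype.card_fin, nsmul_eq_mul] at hsum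
    exact eq_inv_of_mul_eq_one_right hsum
  · have := integral_inner_mul_inner_sphereUniform_of_inner_eq_zero hd
      (u := EuclideanSpace.single i (1 : ℝ)) (v := EuclideanSpace.single j (1 : ℝ))
      (by rw [hs]; simp [hij])
    simpa only [hs] using this

/-- The second moment identity `E[e eᵀ] = d⁻¹ I` for `e` uniform on the sphere. -/
theorem integral_inner_smul_sphereUniform {d : ℕ} (hd : 1 ≤ d) (g : EuclideanSpace ℝ (Fin d)) :
    ∫ e, ⟪g, e⟫ • e ∂(sphereUniform d) = (d : ℝ)⁻¹ • g := by
  have := isProbabilityMeasure_sphereUniform hd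
  have hint : Integrable (fun e => ⟪g, e⟫ • e) (sphereUniform d) := by
    refine Integrable.of_bound (by fun_prop) ‖g‖ ?_
    filter_upwards [ae_norm_eq_one_sphereUniform d] with e he
    simpa [norm_smul, he] using norm_inner_le_norm (𝕜 := ℝ) g e
  have hs : ∀ (k : Fin d) (e : EuclideanSpace ℝ (Fin d)),
      ⟪EuclideanSpace.single k (1 : ℝ), e⟫ = e k := fun k e => by
    simp [EuclideanSpace.inner_single_left]
  ext i
  rw [← hs i, ← integral_inner hint]
  calc _ = ∫ e, ∑ j, g j * (e j * e i) ∂(sphereUniform d) := by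
        refine integral_congr_ae (.of_forall fun e => ?_)
        simp only [hs, PiLp.smul_apply, smul_eq_mul]
        rw [PiLp.inner_apply, Finset.sum_mul]
        refine Finset.sum_congr rfl fun j _ => ?_
        simp
        ring
    _ = ∑ j, g j * ∫ e, e j * e i ∂(sphereUniform d) := by
        rw [integral_finsetSum]
        · simp_rw [integral_const_mul]
        · intro j _
          refine Integrable.const_mul ?_ _
          simpa only [hs] using integrable_inner_mul_inner_sphereUniform hd
            (EuclideanSpace.single j 1) (EuclideanSpace.single i 1)
    _ = _ := by
        simp [integral_coord_mul_coord_sphereUniform hd, mul_comm]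

/-- The polynomial `a t + ∑ c_j t^j` integrated against a kernel whose moments of order
`2, …, l` vanish and whose first moment is one. -/
theorem integral_linear_add_sum_mul_kernel {l : ℕ} {ν : Measure ℝ} {K : ℝ → ℝ}
    (hKint : ∀ j : ℕ, j ≤ l → Integrable (fun t => t ^ j * K t) ν)
    (hK1 : (∫ t, t * K t ∂ν) = 1)
    (hKj : ∀ j : ℕ, 2 ≤ j → j ≤ l → (∫ t, t ^ j * K t ∂ν) = 0) (a : ℝ) (c : ℕ → ℝ) :
    ∫ t, (a * t + ∑ j ∈ Finset.Icc 2 l, c j * t ^ j) * K t ∂ν = a := by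
  have h1 : Integrable (fun t => t * K t) ν := by
    by_contra hn
    rw [integral_undef hn] at hK1
    exact zero_ne_one hK1
  have hj : ∀ j ∈ Finset.Icc 2 l, Integrable (fun t => c j * (t ^ j * K t)) ν := fun j hj =>
    (hKint j (Finset.mem_Icc.1 hj).2).const_mul _
  simp_rw [add_mul, Finset.sum_mul, mul_assoc]
  rw [integral_add (h1.const_mul a) (integrable_finsetSum _ hj), integral_finsetSum _ hj]
  simp_rw [integral_const_mul]
  rw [hK1, Finset.sum_eq_zero, mul_one, add_zero]
  intro j hj
  rw [hKj j (Finset.mem_Icc.1 hj).1 (Finset.mem_Icc.1 hj).2, mul_zero]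

/-- Kernel property: the kernel estimator is unbiased on the polynomial part of the
Taylor expansion. If `e` is uniform on the unit sphere, `r` has law `ν` independent
of `e` with `E[r K(r)] = 1` and `E[r^{|n|} K(r)] = 0` for `2 ≤ |n| ≤ l`, then
`E[(d/h)(⟨∇f(x), h r e⟩ + Σ_{2≤|n|≤l} ((rh)^{|n|}/n!) D^n f(x) e^n) K(r) e] = ∇f(x)`. -/
theorem stmt14 (d : ℕ) (hd : 1 ≤ d) (l : ℕ) (f : EuclideanSpace ℝ (Fin d) → ℝ)
    (x : EuclideanSpace ℝ (Fin d)) (hf : ContDiffAt ℝ l f x)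
    (ν : Measure ℝ) [IsProbabilityMeasure ν] (K : ℝ → ℝ) (hK : Measurable K)
    (hKint : ∀ j : ℕ, j ≤ l → Integrable (fun t => t ^ j * K t) ν)
    (hK1 : (∫ t, t * K t ∂ν) = 1)
    (hKj : ∀ j : ℕ, 2 ≤ j → j ≤ l → (∫ t, t ^ j * K t ∂ν) = 0)
    (h : ℝ) (hh : 0 < h) :
    (∫ e, ∫ r,
        (((d : ℝ) / h) *
          ((⟪gradient f x, (h * r) • e⟫ +
            ∑ j ∈ Finset.Icc 2 l, ∑ n ∈ Finset.Nat.antidiagonalTuple d j,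
              (r * h) ^ j / (∏ i, (Nat.factorial (n i) : ℝ)) *
                multiDeriv n f x * ∏ i, e i ^ n i) * K r)) • e
        ∂ν ∂(sphereUniform d)) = gradient f x := by
  have hd0 : (d : ℝ) ≠ 0 := by positivity
  have hinner : ∀ e : EuclideanSpace ℝ (Fin d), (∫ r,
        (((d : ℝ) / h) *
          ((⟪gradient f x, (h * r) • e⟫ +
            ∑ j ∈ Finset.Icc 2 l, ∑ n ∈ Finset.Nat.antidiagonalTuple d j,
              (r * h) ^ j / (∏ i, (Nat.factorial (n i) : ℝ)) *
                multiDeriv n f x * ∏ i, e i ^ n i) * K r)) • e ∂ν) =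
      (d : ℝ) • (⟪gradient f x, e⟫ • e) := by
    intro e
    rw [integral_smul_const, integral_const_mul, smul_smul]
    congr 1
    have key := integral_linear_add_sum_mul_kernel hKint hK1 hKj (h * ⟪gradient f x, e⟫)
      (fun j => ∑ n ∈ Finset.Nat.antidiagonalTuple d j,
        h ^ j / (∏ i, (Nat.factorial (n i) : ℝ)) * multiDeriv n f x * ∏ i, e i ^ n i)
    rw [show (d : ℝ) * ⟪gradient f x, e⟫ = d / h * (h * ⟪gradient f x, e⟫) by field_simp,
      ← key]
    congr 1
    refine integral_congr_ae (.of_forall fun r => ?_)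
    simp only [inner_smul_right, Finset.sum_mul, mul_pow]
    congr 2
    · ring
    · refine Finset.sum_congr rfl fun j _ => Finset.sum_congr rfl fun n _ => ?_
      ring
  simp_rw [hinner]
  rw [integral_smul, integral_inner_smul_sphereUniform hd, smul_smul, mul_inv_cancel₀ hd0,
    one_smul]
end
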